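/- arXiv:2403.09657 — 4 statements merged into one kernel-verified Lean document; each statement's English description precedes it below -/
import Mathlib

section
/- Let n ≥ 1 be an integer and let z be a complex number with sin(nz) ≠ 0. Then ∑_{k=0}^{n-1} 1/sin²(z + kπ/n) = n²/sin²(nz). -/
open Finset in
lemma sq_one_sub_mul_sum_mul_pow {R : Type*} [CommRing R] (u : R) (n : ℕ) :
    (1 - u) ^ 2 * ∑ j ∈ range n, (j : R) * u ^ j = u - n * u ^ n + (n - 1) * u ^ (n + 1) := by
  induction n with
  | zero => simp
  | succ n ih =>
    rw [sum_range_succ, mul_add, ih]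
    push_cast
    ring

open Finset in
lemma div_one_sub_sq_eq_sum {K : Type*} [Field K] {u : K} {n : ℕ} (hu : 1 - u ^ n ≠ 0) :
    u / (1 - u) ^ 2 =
      ∑ j ∈ range n, ((1 - u ^ n) * j + n * u ^ n) / (1 - u ^ n) ^ 2 * u ^ j := by
  have hgeom : (1 - u) * ∑ j ∈ range n, u ^ j = 1 - u ^ n := mul_neg_geom_sum u n
  have hu1 : 1 - u ≠ 0 := left_ne_zero_of_mul (hgeom ▸ hu)
  have hsplit : ∑ j ∈ range n, ((1 - u ^ n) * j + n * u ^ n) / (1 - u ^ n) ^ 2 * u ^ j =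
      ((1 - u ^ n) * ∑ j ∈ range n, (j : K) * u ^ j + n * u ^ n * ∑ j ∈ range n, u ^ j) /
        (1 - u ^ n) ^ 2 := by
    rw [mul_sum, mul_sum, ← sum_add_distrib, sum_div]
    exact sum_congr rfl fun j _ => by ring
  rw [hsplit, div_eq_div_iff (pow_ne_zero 2 hu1) (pow_ne_zero 2 hu)]
  linear_combination (-(1 - u ^ n)) * sq_one_sub_mul_sum_mul_pow u n -
    n * u ^ n * (1 - u) * hgeom

open Finset in
lemma IsPrimitiveRoot.sum_pow_mul_eq_zero {R : Type*} [CommRing R] [IsDomain R] {ζ : R} {n j : ℕ}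
    (hζ : IsPrimitiveRoot ζ n) (hj0 : j ≠ 0) (hj : j < n) :
    ∑ k ∈ range n, (ζ ^ k) ^ j = 0 := by
  have h : (1 - ζ ^ j) * ∑ k ∈ range n, (ζ ^ j) ^ k = 0 := by
    rw [mul_neg_geom_sum, pow_right_comm, hζ.pow_eq_one, one_pow, sub_self]
  simp_rw [pow_right_comm ζ _ j]
  exact (mul_eq_zero.mp h).resolve_left
    (sub_ne_zero.mpr (hζ.pow_ne_one_of_pos_of_lt hj0 hj).symm)

open Finset in
lemma IsPrimitiveRoot.sum_div_one_sub_sq {K : Type*} [Field K] {ζ w : K} {n : ℕ}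
    (hζ : IsPrimitiveRoot ζ n) (hn : 1 ≤ n) (hw : 1 - w ^ n ≠ 0) :
    ∑ k ∈ range n, w * ζ ^ k / (1 - w * ζ ^ k) ^ 2 = n ^ 2 * w ^ n / (1 - w ^ n) ^ 2 := by
  have hpow (k : ℕ) : (w * ζ ^ k) ^ n = w ^ n := by
    rw [mul_pow, pow_right_comm, hζ.pow_eq_one, one_pow, mul_one]
  have hterm (k : ℕ) : w * ζ ^ k / (1 - w * ζ ^ k) ^ 2 =
      ∑ j ∈ range n, ((1 - w ^ n) * j + n * w ^ n) / (1 - w ^ n) ^ 2 * w ^ j * (ζ ^ k) ^ j := by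
    rw [div_one_sub_sq_eq_sum (n := n) (by rwa [hpow]), hpow]
    exact sum_congr rfl fun j _ => by rw [mul_pow, mul_assoc]
  simp_rw [hterm]
  rw [sum_comm, sum_eq_single_of_mem 0 (mem_range.mpr hn)]
  · simp
    ring
  · intro j hj hj0
    rw [← mul_sum, hζ.sum_pow_mul_eq_zero hj0 (mem_range.mp hj), mul_zero]

lemma Complex.sin_sq_eq_exp (z : ℂ) :
    sin z ^ 2 = -(1 - exp (2 * z * I)) ^ 2 / (4 * exp (2 * z * I)) := by
  have h : exp (2 * z * I) = exp (z * I) ^ 2 := by rw [← exp_nat_mul]; push_cast; ring_nf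
  have h0 := exp_ne_zero (z * I)
  rw [h, sin, neg_mul, exp_neg]
  field_simp
  rw [I_sq]
  ring

lemma Complex.one_div_sin_sq_eq_exp (z : ℂ) :
    1 / sin z ^ 2 = -4 * (exp (2 * z * I) / (1 - exp (2 * z * I)) ^ 2) := by
  rw [sin_sq_eq_exp, one_div_div, div_neg]
  ring

/-- ∑_{k=0}^{n-1} 1/sin²(z + kπ/n) = n²/sin²(nz) for complex z with sin(nz) ≠ 0. -/
theorem sum_inv_sin_sq (n : ℕ) (hn : 1 ≤ n) (z : ℂ) (h : Complex.sin (n * z) ≠ 0) :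
    ∑ k ∈ Finset.range n, 1 / (Complex.sin (z + (k : ℂ) * (Real.pi : ℂ) / n)) ^ 2
      = (n : ℂ) ^ 2 / (Complex.sin (n * z)) ^ 2 := by
  have hζ := Complex.isPrimitiveRoot_exp n (by lia)
  have hexp_mul : Complex.exp (2 * (n * z) * Complex.I) =
      Complex.exp (2 * z * Complex.I) ^ n := by
    rw [← Complex.exp_nat_mul]
    ring_nf
  have hexp_add (k : ℕ) : Complex.exp (2 * (z + (k : ℂ) * (Real.pi : ℂ) / n) * Complex.I) =
      Complex.exp (2 * z * Complex.I) * Complex.exp (2 * Real.pi * Complex.I / n) ^ k := by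
    rw [← Complex.exp_nat_mul, ← Complex.exp_add]
    ring_nf
  have hw : 1 - Complex.exp (2 * z * Complex.I) ^ n ≠ 0 := by
    intro h0
    apply pow_ne_zero 2 h
    simp [Complex.sin_sq_eq_exp, hexp_mul, h0]
  rw [← mul_one_div ((n : ℂ) ^ 2)]
  simp_rw [Complex.one_div_sin_sq_eq_exp, hexp_add, hexp_mul]
  rw [← Finset.mul_sum, hζ.sum_div_one_sub_sq hn hw]
  ring
end

section
/- Let n ≥ 1 be an integer and let z be a complex number with sin(nz) ≠ 0. Then ∑_{k=0}^{n-1} cot(z + kπ/n) = n·cot(nz), where cot w = cos w / sin w. -/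
/-- The complex cotangent as cos/sin. -/
noncomputable def ccot (w : ℂ) : ℂ := Complex.cos w / Complex.sin w

theorem IsPrimitiveRoot.sum_pow_pow_eq_zero {R : Type*} [CommRing R] [IsDomain R] {ζ : R} {n j : ℕ}
    (hζ : IsPrimitiveRoot ζ n) (hj : j ≠ 0) (hjn : j < n) :
    ∑ k ∈ Finset.range n, (ζ ^ j) ^ k = 0 := by
  have h := geom_sum_mul (ζ ^ j) n
  rw [← pow_mul, mul_comm j n, pow_mul, hζ.pow_eq_one, one_pow, sub_self] at h
  exact (mul_eq_zero.mp h).resolve_right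
    (sub_ne_zero.mpr (hζ.pow_ne_one_of_pos_of_lt hj hjn))

theorem IsPrimitiveRoot.sum_inv_mul_pow_sub_one {K : Type*} [Field K] {ζ : K} {n : ℕ}
    (hζ : IsPrimitiveRoot ζ n) (hn : n ≠ 0) {u : K} (hu : u ^ n ≠ 1) :
    ∑ k ∈ Finset.range n, (u * ζ ^ k - 1)⁻¹ = n / (u ^ n - 1) := by
  have hpow (k : ℕ) : (u * ζ ^ k) ^ n = u ^ n := by
    rw [mul_pow, ← pow_mul, mul_comm k n, pow_mul, hζ.pow_eq_one, one_pow, mul_one]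
  have hu' : u ^ n - 1 ≠ 0 := sub_ne_zero.mpr hu
  have hterm (k : ℕ) :
      (u * ζ ^ k - 1)⁻¹ = (∑ j ∈ Finset.range n, (u * ζ ^ k) ^ j) / (u ^ n - 1) := by
    have hg := geom_sum_mul (u * ζ ^ k) n
    rw [hpow] at hg
    have hne : u * ζ ^ k - 1 ≠ 0 := fun h0 ↦ hu' (by rw [← hg, h0, mul_zero])
    rw [eq_div_iff hu', ← hg]
    field_simp
  simp_rw [hterm]
  rw [← Finset.sum_div, Finset.sum_comm, Finset.sum_eq_single 0]
  · simp
  · intro j hj hj0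
    rw [← mul_zero (u ^ j), ← hζ.sum_pow_pow_eq_zero hj0 (Finset.mem_range.mp hj), Finset.mul_sum]
    exact Finset.sum_congr rfl fun k _ ↦ by rw [mul_pow, pow_right_comm]
  · simp [hn]

theorem Complex.exp_two_mul_I_sub_one (w : ℂ) :
    exp (2 * w * I) - 1 = 2 * I * exp (w * I) * sin w := by
  have h1 : exp (2 * w * I) = exp (w * I) * exp (w * I) := by rw [← exp_add]; ring_nf
  have h2 : exp (w * I) * exp (-w * I) = 1 := by rw [← exp_add]; simp
  rw [h1, sin]
  linear_combination h2 - (exp (w * I) * exp (-w * I) - exp (w * I) ^ 2) * I_sq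

theorem ccot_eq_exp {w : ℂ} (hw : Complex.exp (2 * w * Complex.I) ≠ 1) :
    ccot w = Complex.I * (1 + 2 * (Complex.exp (2 * w * Complex.I) - 1)⁻¹) := by
  have h := Complex.exp_two_mul_I_sub_one w
  have hs : Complex.sin w ≠ 0 := fun h0 ↦ hw (sub_eq_zero.mp (by rw [h, h0, mul_zero]))
  have he := Complex.exp_ne_zero (w * Complex.I)
  have hE : Complex.exp (-(w * Complex.I)) * Complex.exp (w * Complex.I) = 1 := by
    rw [← Complex.exp_add]; simp
  have hcs : Complex.cos w - Complex.I * Complex.sin w = Complex.exp (-(w * Complex.I)) := by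
    rw [← neg_mul, Complex.exp_mul_I, Complex.cos_neg, Complex.sin_neg]; ring
  rw [h, ccot, div_eq_iff hs]
  generalize Complex.exp (w * Complex.I) = e at he hE ⊢
  field_simp
  linear_combination e * hcs + hE

/-- ∑_{k=0}^{n-1} cot(z + kπ/n) = n·cot(nz) for complex z with sin(nz) ≠ 0. -/
theorem sum_cot (n : ℕ) (hn : 1 ≤ n) (z : ℂ) (h : Complex.sin (n * z) ≠ 0) :
    ∑ k ∈ Finset.range n, ccot (z + (k : ℂ) * (Real.pi : ℂ) / n)
      = (n : ℂ) * ccot (n * z) := by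
  have hn0 : n ≠ 0 := by omega
  have hζ := Complex.isPrimitiveRoot_exp n hn0
  set ζ := Complex.exp (2 * Real.pi * Complex.I / n)
  set u := Complex.exp (2 * z * Complex.I) with hu
  have hun : Complex.exp (2 * (n * z) * Complex.I) = u ^ n := by
    rw [hu, ← Complex.exp_nat_mul]; ring_nf
  have hu1 : u ^ n ≠ 1 := by
    rw [← hun, ← sub_ne_zero, Complex.exp_two_mul_I_sub_one]
    simp [h]
  have hexp (k : ℕ) :
      Complex.exp (2 * (z + (k : ℂ) * (Real.pi : ℂ) / n) * Complex.I) = u * ζ ^ k := by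
    rw [hu, ← Complex.exp_nat_mul, ← Complex.exp_add]; ring_nf
  have hne (k : ℕ) : u * ζ ^ k ≠ 1 := fun h1 ↦ hu1 <| by
    rw [← one_pow n, ← h1, mul_pow, ← pow_mul, mul_comm k n, pow_mul, hζ.pow_eq_one, one_pow,
      mul_one]
  have hterm (k : ℕ) : ccot (z + (k : ℂ) * (Real.pi : ℂ) / n)
      = Complex.I * (1 + 2 * (u * ζ ^ k - 1)⁻¹) := by
    rw [ccot_eq_exp (by rw [hexp]; exact hne k), hexp]
  rw [ccot_eq_exp (by rwa [hun]), hun]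
  simp_rw [hterm]
  rw [← Finset.mul_sum, Finset.sum_add_distrib, ← Finset.mul_sum,
    hζ.sum_inv_mul_pow_sub_one hn0 hu1]
  simp
  ring
end

section
/- Fix τ ∈ ℂ with Im τ > 0, set Λ = ℤ + τℤ and q = exp(iπτ). For every z ∈ ℂ, σ(z, τ) = exp((z²/2)·δ₂(τ)) · θ₁(πz|τ) / (π·θ₁′(0|τ)). -/
/-- Jacobi theta function θ₁(z|τ), nome q = exp(iπτ). -/
noncomputable def theta1 (z τ : ℂ) : ℂ :=
  2 * ∑' n : ℕ, (-1) ^ n * Complex.exp (Real.pi * Complex.I * τ * ((n : ℂ) + 1 / 2) ^ 2) *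
      Complex.sin ((2 * (n : ℂ) + 1) * z)

/-- θ₁′(0|τ), the z-derivative of θ₁ at 0. -/
noncomputable def theta1deriv (τ : ℂ) : ℂ :=
  2 * ∑' n : ℕ, (-1) ^ n * (2 * (n : ℂ) + 1) *
      Complex.exp (Real.pi * Complex.I * τ * ((n : ℂ) + 1 / 2) ^ 2)

/-- Weierstrass sigma function for the lattice ℤ·g₁ + ℤ·g₂. -/
noncomputable def wSigma (g1 g2 z : ℂ) : ℂ :=
  z * ∏' p : {p : ℤ × ℤ // p ≠ 0},
      ((1 - z / ((p.1.1 : ℂ) * g1 + (p.1.2 : ℂ) * g2)) *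
        Complex.exp (z / ((p.1.1 : ℂ) * g1 + (p.1.2 : ℂ) * g2) +
          z ^ 2 / (2 * ((p.1.1 : ℂ) * g1 + (p.1.2 : ℂ) * g2) ^ 2)))

/-- The iterated Eisenstein sum δ₂(τ) (inner sum over m first, then over n). -/
noncomputable def delta2 (τ : ℂ) : ℂ :=
  ∑' n : ℤ, ∑' m : ℤ, if (m, n) = ((0 : ℤ), (0 : ℤ)) then 0 else 1 / ((m : ℂ) + (n : ℂ) * τ) ^ 2

section

open Filter Topology

/-- The finite `q`-Pochhammer product `(q; q)_n = ∏_{k=1}^n (1 - q ^ k)`. -/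
noncomputable def qPoch (q : ℂ) (n : ℕ) : ℂ := ∏ k ∈ Finset.range n, (1 - q ^ (k + 1))

/-- The infinite `q`-Pochhammer product `(q; q)_∞`. -/
noncomputable def qPochInf (q : ℂ) : ℂ := ∏' k : ℕ, (1 - q ^ (k + 1))

/-- The reciprocal of `(q; q)_n`, extended by zero to negative `n`. -/
noncomputable def qPochInv (q : ℂ) (n : ℤ) : ℂ := if n < 0 then 0 else (qPoch q n.toNat)⁻¹

lemma one_sub_pow_succ_ne_zero {q : ℂ} (hq : ‖q‖ < 1) (n : ℕ) : 1 - q ^ (n + 1) ≠ 0 := by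
  intro h
  have h1 : ‖q‖ ^ (n + 1) = 1 := by rw [← norm_pow, ← sub_eq_zero.mp h, norm_one]
  exact (pow_lt_one₀ (norm_nonneg q) hq n.succ_ne_zero).ne h1

lemma qPoch_ne_zero {q : ℂ} (hq : ‖q‖ < 1) (n : ℕ) : qPoch q n ≠ 0 :=
  Finset.prod_ne_zero_iff.mpr fun k _ ↦ one_sub_pow_succ_ne_zero hq k

lemma summable_norm_neg_pow_succ {q : ℂ} (hq : ‖q‖ < 1) :
    Summable fun n : ℕ ↦ ‖-q ^ (n + 1)‖ := by
  simpa [pow_succ] using (summable_geometric_of_lt_one (norm_nonneg q) hq).mul_right ‖q‖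

lemma qPochInf_ne_zero {q : ℂ} (hq : ‖q‖ < 1) : qPochInf q ≠ 0 := by
  simpa [qPochInf, sub_eq_add_neg] using
    tprod_one_add_ne_zero_of_summable (f := fun n : ℕ ↦ -q ^ (n + 1))
      (fun n ↦ by simpa [sub_eq_add_neg] using one_sub_pow_succ_ne_zero hq n)
      (summable_norm_neg_pow_succ hq)

lemma tendsto_qPoch {q : ℂ} (hq : ‖q‖ < 1) : Tendsto (qPoch q) atTop (𝓝 (qPochInf q)) :=
  (ModularForm.multipliable_one_sub_pow hq).hasProd.tendsto_prod_nat

lemma qPochInv_sub_one {q : ℂ} (hq : ‖q‖ < 1) (n : ℤ) :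
    qPochInv q (n - 1) = (1 - q ^ n) * qPochInv q n := by
  rcases lt_trichotomy n 0 with h | rfl | h
  · simp [qPochInv, h, h.trans zero_lt_one]
  · simp [qPochInv]
  · obtain ⟨k, rfl⟩ : ∃ k : ℕ, n = k + 1 := ⟨(n - 1).toNat, by omega⟩
    have h1 := one_sub_pow_succ_ne_zero hq k
    have h2 := qPoch_ne_zero hq k
    have h3 : ¬ ((k : ℤ) + 1 < 0) := by omega
    have h4 : qPoch q (k + 1) = qPoch q k * (1 - q ^ (k + 1)) := Finset.prod_range_succ _ _
    have h5 : ((k : ℤ) + 1).toNat = k + 1 := by omega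
    have h6 : q ^ ((k : ℤ) + 1) = q ^ (k + 1) := by exact_mod_cast zpow_natCast q (k + 1)
    simp only [qPochInv, h3, if_false, h5, h6, h4, add_sub_cancel_right, Int.toNat_natCast,
      Int.natCast_nonneg, not_lt.mpr]
    field_simp

lemma exists_norm_qPochInv_le {q : ℂ} (hq : ‖q‖ < 1) : ∃ C, ∀ n, ‖qPochInv q n‖ ≤ C := by
  obtain ⟨C, hC⟩ := ((tendsto_qPoch hq).inv₀ (qPochInf_ne_zero hq)).norm.bddAbove_range
  refine ⟨C, fun n ↦ ?_⟩
  have h0 : ‖(qPoch q n.toNat)⁻¹‖ ≤ C := hC ⟨n.toNat, rfl⟩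
  unfold qPochInv
  split_ifs
  · simpa using (norm_nonneg _).trans h0
  · exact h0

lemma tendsto_qPochInv_comp {q : ℂ} (hq : ‖q‖ < 1) {u : ℕ → ℤ} (hu : Tendsto u atTop atTop) :
    Tendsto (fun N ↦ qPochInv q (u N)) atTop (𝓝 (qPochInf q)⁻¹) := by
  have h1 : Tendsto (fun N ↦ (u N).toNat) atTop atTop :=
    tendsto_atTop.mpr fun b ↦ (hu.eventually_ge_atTop b).mono fun N hN ↦ by omega
  refine (((tendsto_qPoch hq).inv₀ (qPochInf_ne_zero hq)).comp h1).congr' ?_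
  filter_upwards [hu.eventually_ge_atTop 0] with N hN
  simp [qPochInv, not_lt.mpr hN]

/-- The finite form of the Jacobi triple product identity. -/
lemma hasSum_finite_triple_product {q x : ℂ} (hq0 : q ≠ 0) (hq : ‖q ^ 2‖ < 1) (hx : x ≠ 0) (N : ℕ) :
    HasSum (fun n : ℤ ↦ qPoch (q ^ 2) (2 * N) * qPochInv (q ^ 2) (N - n) *
        qPochInv (q ^ 2) (N + n) * (q ^ (n ^ 2) * x ^ n))
      (∏ k ∈ Finset.range N, ((1 + x * q ^ (2 * k + 1)) * (1 + x⁻¹ * q ^ (2 * k + 1)))) := by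
  induction N with
  | zero =>
    have h0 : ∀ n : ℤ, n ≠ 0 → qPoch (q ^ 2) (2 * 0) * qPochInv (q ^ 2) ((0 : ℕ) - n) *
        qPochInv (q ^ 2) ((0 : ℕ) + n) * (q ^ (n ^ 2) * x ^ n) = 0 := by
      intro n hn
      rcases hn.lt_or_gt with h | h <;> simp [qPochInv, h]
    simpa [qPochInv, qPoch] using hasSum_single (0 : ℤ) h0
  | succ N ih =>
    rw [Finset.prod_range_succ]
    have hl := ((Equiv.subRight (1 : ℤ)).hasSum_iff).mpr ih
    have hr := ((Equiv.addRight (1 : ℤ)).hasSum_iff).mpr ih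
    have h := ((ih.mul_right (1 + q ^ (4 * N + 2))).add (hl.mul_right (x * q ^ (2 * N + 1)))).add
      (hr.mul_right (x⁻¹ * q ^ (2 * N + 1)))
    rw [← mul_add, ← mul_add, show 1 + q ^ (4 * N + 2) + x * q ^ (2 * N + 1) +
      x⁻¹ * q ^ (2 * N + 1) = (1 + x * q ^ (2 * N + 1)) * (1 + x⁻¹ * q ^ (2 * N + 1)) by
        field_simp; ring] at h
    refine h.congr_fun fun n ↦ ?_
    have e1 : ((N : ℤ) - n) = (N + 1 - n) - 1 := by ring
    have e2 : ((N : ℤ) + n) = (N + 1 + n) - 1 := by ring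
    have e3 : ((N : ℤ) - (n - 1)) = N + 1 - n := by ring
    have e4 : ((N : ℤ) + (n - 1)) = (N + 1 + n) - 1 - 1 := by ring
    have e5 : ((N : ℤ) - (n + 1)) = (N + 1 - n) - 1 - 1 := by ring
    have e6 : ((N : ℤ) + (n + 1)) = N + 1 + n := by ring
    have e7 : qPoch (q ^ 2) (2 * (N + 1)) = qPoch (q ^ 2) (2 * N) *
        (1 - (q ^ 2) ^ (2 * N + 1)) * (1 - (q ^ 2) ^ (2 * N + 2)) := by
      rw [mul_add, mul_one, qPoch, Finset.prod_range_succ, Finset.prod_range_succ, ← qPoch]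
    simp only [Function.comp_apply, Equiv.subRight_apply, Equiv.coe_addRight, Nat.cast_add,
      Nat.cast_one, e1, e2, e3, e4, e5, e6, e7, qPochInv_sub_one hq]
    generalize qPochInv (q ^ 2) (N + 1 - n) = A
    generalize qPochInv (q ^ 2) (N + 1 + n) = B
    generalize qPoch (q ^ 2) (2 * N) = P
    have hQ : q ^ 2 ≠ 0 := pow_ne_zero 2 hq0
    have f1 : q ^ ((n - 1) ^ 2) * x ^ (n - 1) * (x * q ^ (2 * N + 1)) =
        (q ^ 2) ^ ((N : ℤ) + 1 - n) * (q ^ (n ^ 2) * x ^ n) := by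
      rw [← zpow_natCast q 2, ← zpow_natCast q (2 * N + 1), ← zpow_mul, zpow_sub_one₀ hx,
        show q ^ ((n - 1) ^ 2) * (x ^ n * x⁻¹) * (x * q ^ ((2 * N + 1 : ℕ) : ℤ)) =
          (q ^ ((n - 1) ^ 2) * q ^ ((2 * N + 1 : ℕ) : ℤ)) * x ^ n by field_simp,
        ← mul_assoc, ← zpow_add₀ hq0, ← zpow_add₀ hq0]
      congr 2
      push_cast
      ring
    have f2 : q ^ ((n + 1) ^ 2) * x ^ (n + 1) * (x⁻¹ * q ^ (2 * N + 1)) =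
        (q ^ 2) ^ ((N : ℤ) + 1 + n) * (q ^ (n ^ 2) * x ^ n) := by
      rw [← zpow_natCast q 2, ← zpow_natCast q (2 * N + 1), ← zpow_mul, zpow_add_one₀ hx,
        show q ^ ((n + 1) ^ 2) * (x ^ n * x) * (x⁻¹ * q ^ ((2 * N + 1 : ℕ) : ℤ)) =
          (q ^ ((n + 1) ^ 2) * q ^ ((2 * N + 1 : ℕ) : ℤ)) * x ^ n by field_simp,
        ← mul_assoc, ← zpow_add₀ hq0, ← zpow_add₀ hq0]
      congr 2
      push_cast
      ring
    simp only [mul_assoc] at f1 f2 ⊢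
    simp only [f1, f2]
    have g1 : (q ^ 2) ^ ((N : ℤ) + 1 - n) * (q ^ 2) ^ ((N : ℤ) + 1 + n) =
        (q ^ 2) ^ (2 * N + 2) := by
      rw [← zpow_add₀ hQ, ← zpow_natCast (q ^ 2) (2 * N + 2)]
      congr 1
      push_cast
      ring
    have g2 : (q ^ 2) ^ ((N : ℤ) + 1 - n - 1) = (q ^ 2) ^ ((N : ℤ) + 1 - n) / q ^ 2 := by
      rw [zpow_sub_one₀ hQ, div_eq_mul_inv]
    have g3 : (q ^ 2) ^ ((N : ℤ) + 1 + n - 1) = (q ^ 2) ^ ((N : ℤ) + 1 + n) / q ^ 2 := by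
      rw [zpow_sub_one₀ hQ, div_eq_mul_inv]
    have g4 : (q ^ 2) ^ (2 * N + 1) = (q ^ 2) ^ ((N : ℤ) + 1 - n) *
        (q ^ 2) ^ ((N : ℤ) + 1 + n) / q ^ 2 := by
      rw [g1, eq_div_iff hQ, ← pow_succ]
    have g5 : q ^ (4 * N + 2) = (q ^ 2) ^ ((N : ℤ) + 1 - n) *
        (q ^ 2) ^ ((N : ℤ) + 1 + n) / q ^ 2 := by
      rw [← g4, ← pow_mul]
      congr 1
      ring
    rw [g2, g3, g4, g5, ← g1]
    generalize (q ^ 2) ^ ((N : ℤ) + 1 - n) = s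
    generalize (q ^ 2) ^ ((N : ℤ) + 1 + n) = t
    field_simp
    ring

/-- The Jacobi triple product identity. -/
lemma tsum_triple_product {q x P : ℂ} (hq0 : q ≠ 0) (hq : ‖q‖ < 1) (hx : x ≠ 0)
    (hs : Summable fun n : ℤ ↦ ‖q ^ (n ^ 2) * x ^ n‖)
    (hP : HasProd (fun k : ℕ ↦ (1 + x * q ^ (2 * k + 1)) * (1 + x⁻¹ * q ^ (2 * k + 1))) P) :
    ∑' n : ℤ, q ^ (n ^ 2) * x ^ n = qPochInf (q ^ 2) * P := by
  have hq2 : ‖q ^ 2‖ < 1 := by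
    rw [norm_pow]
    exact pow_lt_one₀ (norm_nonneg q) hq two_ne_zero
  have hA := qPochInf_ne_zero hq2
  obtain ⟨C, hC⟩ := exists_norm_qPochInv_le hq2
  obtain ⟨D, hD⟩ := (tendsto_qPoch hq2).norm.bddAbove_range
  have hC0 : 0 ≤ C := (norm_nonneg _).trans (hC 0)
  have hD' (n : ℕ) : ‖qPoch (q ^ 2) n‖ ≤ D := hD ⟨n, rfl⟩
  have hD0 : 0 ≤ D := (norm_nonneg _).trans (hD' 0)
  have key := tendsto_tsum_of_dominated_convergence (𝓕 := atTop)
    (f := fun (N : ℕ) (n : ℤ) ↦ qPoch (q ^ 2) (2 * N) * qPochInv (q ^ 2) (N - n) *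
        qPochInv (q ^ 2) (N + n) * (q ^ (n ^ 2) * x ^ n))
    (g := fun n : ℤ ↦ qPochInf (q ^ 2) * (qPochInf (q ^ 2))⁻¹ * (qPochInf (q ^ 2))⁻¹ *
      (q ^ (n ^ 2) * x ^ n)) (hs.mul_left (D * C * C)) (fun n ↦ ?_)
    (Eventually.of_forall fun N n ↦ ?_)
  · simp_rw [(hasSum_finite_triple_product hq0 hq2 hx _).tsum_eq] at key
    have h := tendsto_nhds_unique hP.tendsto_prod_nat key
    rw [h, tsum_mul_left]
    field_simp
  · have hN : Tendsto (fun N : ℕ ↦ (N : ℤ)) atTop atTop := tendsto_natCast_atTop_atTop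
    refine Tendsto.mul_const _ (((tendsto_qPoch hq2).comp ?_).mul
      (tendsto_qPochInv_comp hq2 ?_) |>.mul (tendsto_qPochInv_comp hq2 ?_))
    · exact tendsto_id.const_mul_atTop' two_pos
    · exact tendsto_atTop_add_const_right _ (-n) hN
    · exact tendsto_atTop_add_const_right _ n hN
  · rw [norm_mul, norm_mul, norm_mul]
    gcongr
    · exact hD' _
    · exact hC _
    · exact hC _

/-- The `z`-dependent factor `∏_{n ≥ 1} (1 - q ^ n w) (1 - q ^ n w⁻¹)` of the product expansion
of the first theta function. -/
noncomputable def thetaProd (q w : ℂ) : ℂ :=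
  ∏' n : ℕ, ((1 - q ^ (n + 1) * w) * (1 - q ^ (n + 1) * w⁻¹))

lemma multipliable_one_sub_pow_mul {q : ℂ} (hq : ‖q‖ < 1) (w : ℂ) :
    Multipliable fun n : ℕ ↦ 1 - q ^ (n + 1) * w := by
  simpa [sub_eq_add_neg] using multipliable_one_add_of_summable
    (f := fun n : ℕ ↦ -q ^ (n + 1) * w)
    (by simpa only [norm_mul] using (summable_norm_neg_pow_succ hq).mul_right ‖w‖)

lemma thetaProd_one {q : ℂ} (hq : ‖q‖ < 1) : thetaProd q 1 = qPochInf q ^ 2 := by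
  have h := multipliable_one_sub_pow_mul hq 1
  rw [thetaProd, inv_one, h.tprod_mul h, qPochInf, sq]
  simp

lemma continuousAt_thetaProd_one {q : ℂ} (hq : ‖q‖ < 1) : ContinuousAt (thetaProd q) 1 := by
  have hc : ContinuousAt (fun w : ℂ ↦ w⁻¹) 1 := continuousAt_inv₀ one_ne_zero
  have h1 : ∀ᶠ w : ℂ in 𝓝 1, ‖w‖ < 2 := by
    refine continuous_norm.continuousAt.eventually_lt continuousAt_const ?_
    norm_num
  have h2 : ∀ᶠ w : ℂ in 𝓝 1, ‖w⁻¹‖ < 2 := by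
    refine hc.norm.eventually_lt continuousAt_const ?_
    norm_num
  have hq1 (n : ℕ) : ‖q ^ (n + 1)‖ ≤ 1 := by
    rw [norm_pow]
    exact pow_le_one₀ (norm_nonneg q) hq.le
  have key := tendsto_tprod_one_add_of_dominated_convergence (𝓕 := 𝓝 (1 : ℂ))
    (f := fun w (n : ℕ) ↦ (1 - q ^ (n + 1) * w) * (1 - q ^ (n + 1) * w⁻¹) - 1)
    (g := fun n : ℕ ↦ (1 - q ^ (n + 1) * 1) * (1 - q ^ (n + 1) * 1⁻¹) - 1)
    (bound := fun n ↦ 5 * ‖-q ^ (n + 1)‖) ((summable_norm_neg_pow_succ hq).mul_left 5)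
    (fun n ↦ ?_) ?_
  · simp only [add_sub_cancel] at key
    exact key
  · have : ContinuousAt (fun w : ℂ ↦
        (1 - q ^ (n + 1) * w) * (1 - q ^ (n + 1) * w⁻¹) - 1) 1 := by fun_prop (disch := simp)
    exact this
  · filter_upwards [h1, h2] with w hw1 hw2 n
    rcases eq_or_ne w 0 with rfl | hw
    · simp
    have e : (1 - q ^ (n + 1) * w) * (1 - q ^ (n + 1) * w⁻¹) - 1 =
        q ^ (n + 1) * (q ^ (n + 1) - (w + w⁻¹)) := by
      field_simp
      ring
    rw [e, norm_mul, norm_neg, mul_comm]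
    gcongr
    calc _ ≤ ‖q ^ (n + 1)‖ + (‖w‖ + ‖w⁻¹‖) :=
          (norm_sub_le _ _).trans (by gcongr; exact norm_add_le _ _)
      _ ≤ 5 := by linarith [hq1 n]

lemma norm_nome_sq_lt_one {τ : ℂ} (hτ : 0 < τ.im) :
    ‖Complex.exp (2 * Real.pi * Complex.I * τ)‖ < 1 := by
  rw [Complex.norm_exp, Real.exp_lt_one_iff]
  simp only [Complex.mul_re, Complex.mul_im, Complex.re_ofNat, Complex.im_ofNat, Complex.ofReal_re,
    Complex.ofReal_im, Complex.I_re, Complex.I_im]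
  nlinarith [Real.pi_pos, mul_pos Real.pi_pos hτ]

/-- The `n`-th term of the bilateral series for `θ₁(π z)`. -/
lemma jacobiTheta₂_term_shift (n : ℤ) (z τ : ℂ) :
    -Complex.I * Complex.exp (Real.pi * Complex.I * τ / 4) *
      Complex.exp (Real.pi * Complex.I * z) * jacobiTheta₂_term n (z + τ / 2 + 1 / 2) τ =
    -Complex.I * ((-1) ^ n * Complex.exp (Real.pi * Complex.I * τ * ((n : ℂ) + 1 / 2) ^ 2) *
      Complex.exp ((2 * (n : ℂ) + 1) * (Real.pi * z) * Complex.I)) := by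
  have h : ((-1 : ℂ)) ^ n = Complex.exp (n * (Real.pi * Complex.I)) := by
    rw [Complex.exp_int_mul, Complex.exp_pi_mul_I]
  rw [jacobiTheta₂_term, h, mul_assoc, mul_assoc, ← Complex.exp_add, ← Complex.exp_add,
    ← Complex.exp_add, ← Complex.exp_add]
  congr 2
  ring

lemma neg_one_zpow_neg_add_one (n : ℕ) : (-1 : ℂ) ^ (-((n : ℤ) + 1)) = -(-1) ^ n := by
  rw [zpow_neg, ← Nat.cast_succ, zpow_natCast, ← inv_pow, inv_neg, inv_one, pow_succ]
  ring

lemma theta1_eq_jacobiTheta₂ {τ : ℂ} (hτ : 0 < τ.im) (z : ℂ) :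
    theta1 (Real.pi * z) τ = -Complex.I * Complex.exp (Real.pi * Complex.I * τ / 4) *
      Complex.exp (Real.pi * Complex.I * z) * jacobiTheta₂ (z + τ / 2 + 1 / 2) τ := by
  have h := ((hasSum_jacobiTheta₂_term (z + τ / 2 + 1 / 2) hτ).mul_left
    (-Complex.I * Complex.exp (Real.pi * Complex.I * τ / 4) *
      Complex.exp (Real.pi * Complex.I * z))).nat_add_neg_add_one
  rw [theta1, ← tsum_mul_left, ← h.tsum_eq]
  refine tsum_congr fun n ↦ ?_
  rw [jacobiTheta₂_term_shift, jacobiTheta₂_term_shift, neg_one_zpow_neg_add_one, Complex.sin]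
  push_cast
  rw [show (-((n : ℂ) + 1) + 1 / 2) ^ 2 = ((n : ℂ) + 1 / 2) ^ 2 by ring,
    show (2 * -((n : ℂ) + 1) + 1) * (Real.pi * z) * Complex.I =
      -((2 * (n : ℂ) + 1) * (Real.pi * z)) * Complex.I by ring, zpow_natCast]
  ring

lemma hasDerivAt_theta1 {τ : ℂ} (hτ : 0 < τ.im) :
    HasDerivAt (fun z ↦ theta1 (Real.pi * z) τ) (Real.pi * theta1deriv τ) 0 := by
  have hf : (fun z ↦ theta1 (Real.pi * z) τ) = fun z ↦
      -Complex.I * Complex.exp (Real.pi * Complex.I * τ / 4) *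
      (Complex.exp (Real.pi * Complex.I * z) * jacobiTheta₂ (z + (τ / 2 + 1 / 2)) τ) := by
    funext z
    rw [theta1_eq_jacobiTheta₂ hτ, mul_assoc, add_assoc]
  have h1 : HasDerivAt (fun z ↦ Complex.exp (Real.pi * Complex.I * z)) (Real.pi * Complex.I) 0 := by
    simpa using ((hasDerivAt_id (0 : ℂ)).const_mul (Real.pi * Complex.I)).cexp
  have h2 := (hasDerivAt_jacobiTheta₂_fst (0 + (τ / 2 + 1 / 2)) hτ).comp_add_const
    0 (τ / 2 + 1 / 2)
  rw [hf]
  refine ((h1.mul h2).const_mul _).congr_deriv ?_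
  rw [mul_zero, Complex.exp_zero, one_mul, zero_add]
  have h := (((hasSum_jacobiTheta₂_term (τ / 2 + 1 / 2) hτ).mul_left (Real.pi * Complex.I)).add
    (hasSum_jacobiTheta₂'_term (τ / 2 + 1 / 2) hτ)).mul_left
      (-Complex.I * Complex.exp (Real.pi * Complex.I * τ / 4))
  have e (n : ℤ) : -Complex.I * Complex.exp (Real.pi * Complex.I * τ / 4) *
      (Real.pi * Complex.I * jacobiTheta₂_term n (τ / 2 + 1 / 2) τ +
        jacobiTheta₂'_term n (τ / 2 + 1 / 2) τ) =
      Real.pi * ((-1) ^ n * (2 * n + 1) *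
        Complex.exp (Real.pi * Complex.I * τ * ((n : ℂ) + 1 / 2) ^ 2)) := by
    have := jacobiTheta₂_term_shift n 0 τ
    simp only [mul_zero, Complex.exp_zero, zero_mul, mul_one, zero_add] at this
    rw [jacobiTheta₂'_term, show ∀ a b c : ℂ, a * b * (Real.pi * Complex.I * c +
      2 * Real.pi * Complex.I * n * c) = Real.pi * Complex.I * (2 * n + 1) * (a * b * c) by
        intros; ring, this]
    linear_combination -Real.pi * (-1) ^ n * (2 * n + 1) *
        Complex.exp (Real.pi * Complex.I * τ * ((n : ℂ) + 1 / 2) ^ 2) * Complex.I_sq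
  simp_rw [e] at h
  rw [theta1deriv, ← tsum_mul_left, ← tsum_mul_left, ← h.nat_add_neg_add_one.tsum_eq]
  refine tsum_congr fun n ↦ ?_
  rw [neg_one_zpow_neg_add_one]
  push_cast
  rw [show (-((n : ℂ) + 1) + 1 / 2) ^ 2 = ((n : ℂ) + 1 / 2) ^ 2 by ring, zpow_natCast]
  ring

/-- The product expansion of the first theta function. -/
lemma theta1_eq_prod {τ : ℂ} (hτ : 0 < τ.im) (z : ℂ) :
    theta1 (Real.pi * z) τ = 2 * Complex.exp (Real.pi * Complex.I * τ / 4) *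
      qPochInf (Complex.exp (2 * Real.pi * Complex.I * τ)) * Complex.sin (Real.pi * z) *
      thetaProd (Complex.exp (2 * Real.pi * Complex.I * τ))
        (Complex.exp (2 * Real.pi * Complex.I * z)) := by
  set q := Complex.exp (Real.pi * Complex.I * τ) with hq_def
  set x := Complex.exp (2 * Real.pi * Complex.I * (z + τ / 2 + 1 / 2)) with hx_def
  set w := Complex.exp (2 * Real.pi * Complex.I * z) with hw_def
  have hQ : Complex.exp (2 * Real.pi * Complex.I * τ) = q ^ 2 := by
    rw [hq_def, ← Complex.exp_nat_mul]
    congr 1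
    push_cast
    ring
  have hQ1 : ‖q ^ 2‖ < 1 := hQ ▸ norm_nome_sq_lt_one hτ
  have hq1 : ‖q‖ < 1 := by
    rw [norm_pow] at hQ1
    exact (pow_lt_one_iff_of_nonneg (norm_nonneg q) two_ne_zero).mp hQ1
  have hxw : x = -w * q := by
    rw [hx_def, hw_def, hq_def, mul_add, mul_add, Complex.exp_add, Complex.exp_add,
      show 2 * Real.pi * Complex.I * (τ / 2) = Real.pi * Complex.I * τ by ring,
      show 2 * Real.pi * Complex.I * (1 / 2) = Real.pi * Complex.I by ring, Complex.exp_pi_mul_I]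
    ring
  have hq0 : q ≠ 0 := Complex.exp_ne_zero _
  have hw0 : w ≠ 0 := Complex.exp_ne_zero _
  have hterm (n : ℤ) : jacobiTheta₂_term n (z + τ / 2 + 1 / 2) τ = q ^ (n ^ 2) * x ^ n := by
    rw [jacobiTheta₂_term, hq_def, hx_def, ← Complex.exp_int_mul, ← Complex.exp_int_mul,
      ← Complex.exp_add]
    congr 1
    push_cast
    ring
  have hs : Summable fun n : ℤ ↦ ‖q ^ (n ^ 2) * x ^ n‖ := by
    simp_rw [← hterm]
    exact ((summable_jacobiTheta₂_term_iff _ τ).mpr hτ).norm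
  have hm1 := multipliable_one_sub_pow_mul hQ1 w
  have hm2 := multipliable_one_sub_pow_mul hQ1 w⁻¹
  have hm3 : HasProd (fun n : ℕ ↦ 1 - (q ^ 2) ^ n * w⁻¹)
      ((1 - w⁻¹) * ∏' n : ℕ, (1 - (q ^ 2) ^ (n + 1) * w⁻¹)) := by
    simpa using hm2.hasProd.zero_mul (f := fun n : ℕ ↦ 1 - (q ^ 2) ^ n * w⁻¹)
  have hP : HasProd (fun k : ℕ ↦ (1 + x * q ^ (2 * k + 1)) * (1 + x⁻¹ * q ^ (2 * k + 1)))
      ((1 - w⁻¹) * thetaProd (q ^ 2) w) := by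
    rw [thetaProd, hm1.tprod_mul hm2, mul_left_comm]
    refine (hm1.hasProd.mul hm3).congr_fun fun k ↦ ?_
    rw [hxw, ← pow_mul, ← pow_mul]
    field_simp
    ring
  rw [theta1_eq_jacobiTheta₂ hτ, jacobiTheta₂, hQ]
  simp_rw [hterm]
  rw [tsum_triple_product hq0 hq1 (Complex.exp_ne_zero _) hs hP, Complex.sin]
  have hw' : Complex.exp (Real.pi * Complex.I * z) * (1 - w⁻¹) =
      Complex.exp (Real.pi * z * Complex.I) - Complex.exp (-(Real.pi * z) * Complex.I) := by
    rw [hw_def, ← Complex.exp_neg, mul_sub, mul_one, ← Complex.exp_add]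
    congr 2 <;> ring
  linear_combination -Complex.I * Complex.exp (Real.pi * Complex.I * τ / 4) * qPochInf (q ^ 2) *
    thetaProd (q ^ 2) w * hw'

lemma theta1deriv_eq {τ : ℂ} (hτ : 0 < τ.im) :
    theta1deriv τ = 2 * Complex.exp (Real.pi * Complex.I * τ / 4) *
      qPochInf (Complex.exp (2 * Real.pi * Complex.I * τ)) ^ 3 := by
  have hQ := norm_nome_sq_lt_one hτ
  set Q := Complex.exp (2 * Real.pi * Complex.I * τ) with hQ_def
  have hπ : (Real.pi : ℂ) ≠ 0 := Complex.ofReal_ne_zero.mpr Real.pi_ne_zero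
  have hs : HasDerivAt (fun z : ℂ ↦ Complex.sin (Real.pi * z)) Real.pi 0 := by
    simpa using ((hasDerivAt_id (0 : ℂ)).const_mul (Real.pi : ℂ)).csin
  have hE : Tendsto (fun z : ℂ ↦ thetaProd Q (Complex.exp (2 * Real.pi * Complex.I * z)))
      (𝓝[≠] 0) (𝓝 (qPochInf Q ^ 2)) := by
    rw [← thetaProd_one hQ]
    have h1 : Tendsto (fun z : ℂ ↦ Complex.exp (2 * Real.pi * Complex.I * z)) (𝓝 0) (𝓝 1) := by
      have : Continuous fun z : ℂ ↦ Complex.exp (2 * Real.pi * Complex.I * z) := by fun_prop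
      simpa using this.tendsto 0
    exact ((continuousAt_thetaProd_one hQ).tendsto.comp h1).mono_left nhdsWithin_le_nhds
  have h1 := hasDerivAt_iff_tendsto_slope.mp (hasDerivAt_theta1 hτ)
  have h2 := ((hasDerivAt_iff_tendsto_slope.mp hs).mul hE).const_mul
    (2 * Complex.exp (Real.pi * Complex.I * τ / 4) * qPochInf Q)
  have h3 := tendsto_nhds_unique h1 (h2.congr fun z ↦ ?_)
  · apply mul_left_cancel₀ hπ
    rw [h3]
    ring
  · simp only [slope_def_field, theta1_eq_prod hτ, ← hQ_def, mul_zero, Complex.sin_zero, zero_mul,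
      sub_zero]
    ring

/-- The genus `2` Weierstrass elementary factor. -/
noncomputable def elemFactor (u : ℂ) : ℂ := (1 - u) * Complex.exp (u + u ^ 2 / 2)

lemma elemFactor_zero : elemFactor 0 = 1 := by simp [elemFactor]

lemma elemFactor_mul_neg (u : ℂ) :
    elemFactor u * elemFactor (-u) = (1 - u ^ 2) * Complex.exp (u ^ 2) := by
  have h : Complex.exp (u ^ 2) = Complex.exp (u + u ^ 2 / 2) * Complex.exp (-u + (-u) ^ 2 / 2) := by
    rw [← Complex.exp_add]
    congr 1
    ring
  rw [h, elemFactor, elemFactor]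
  ring

lemma norm_elemFactor_sub_one_le {u : ℂ} (hu : ‖u‖ ≤ 1) :
    ‖elemFactor u - 1‖ ≤ Real.exp 2 * ‖u‖ ^ 3 := by
  have hd (v : ℂ) : HasDerivAt elemFactor (-v ^ 2 * Complex.exp (v + v ^ 2 / 2)) v := by
    have h1 := (hasDerivAt_id v).const_sub 1
    have h2 := ((hasDerivAt_id v).add (((hasDerivAt_id v).pow 2).div_const 2)).cexp
    refine (h1.mul h2).congr_deriv ?_
    simp
    ring
  have hb : ∀ v ∈ Metric.closedBall (0 : ℂ) ‖u‖,
      ‖-v ^ 2 * Complex.exp (v + v ^ 2 / 2)‖ ≤ Real.exp 2 * ‖u‖ ^ 2 := by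
    intro v hv
    rw [mem_closedBall_zero_iff] at hv
    have hv1 : ‖v + v ^ 2 / 2‖ ≤ 2 := by
      refine (norm_add_le _ _).trans ?_
      rw [norm_div, norm_pow, Complex.norm_ofNat]
      nlinarith [norm_nonneg v]
    rw [norm_mul, norm_neg, norm_pow, mul_comm]
    gcongr
    exact (Complex.norm_exp_le_exp_norm _).trans (Real.exp_le_exp.mpr hv1)
  have h := (convex_closedBall (0 : ℂ) ‖u‖).norm_image_sub_le_of_norm_hasDerivWithin_le
    (fun v _ ↦ (hd v).hasDerivWithinAt) hb (x := 0) (y := u) (by simp) (by simp)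
  rw [elemFactor_zero, sub_zero] at h
  calc _ ≤ _ := h
    _ = _ := by ring

lemma summable_norm_elemFactor_sub_one {ι : Type*} {u : ι → ℂ} (hu : Summable fun i ↦ ‖u i‖ ^ 3) :
    Summable fun i ↦ ‖elemFactor (u i) - 1‖ := by
  refine summable_of_isBigO hu (.of_bound (Real.exp 2) ?_)
  filter_upwards [hu.tendsto_cofinite_zero.eventually_le_const one_pos] with i hi
  rw [pow_le_one_iff_of_nonneg (norm_nonneg _) three_ne_zero] at hi
  simpa using norm_elemFactor_sub_one_le hi

lemma summable_norm_div_lattice_pow_three {τ : ℂ} (hτ : 0 < τ.im) (z : ℂ) :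
    Summable fun p : ℤ × ℤ ↦ ‖z / ((p.2 : ℂ) + p.1 * τ)‖ ^ 3 := by
  have h := (EisensteinSeries.summable_one_div_norm_rpow (k := 3) (by norm_num)).mul_left
    (EisensteinSeries.r ⟨τ, hτ⟩ ^ (-3 : ℝ))
  have h' := (h.of_nonneg_of_le (fun x ↦ by positivity) fun x ↦
    EisensteinSeries.summand_bound ⟨τ, hτ⟩ zero_le_three x).mul_left (‖z‖ ^ 3)
  rw [← (finTwoArrowEquiv _).symm.summable_iff] at h'
  refine h'.congr fun p ↦ ?_
  simp [div_eq_mul_inv, add_comm, mul_pow]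

lemma HasProd.tendsto_int_symm {f : ℤ → ℂ} {a : ℂ} (h : HasProd f a) :
    Tendsto (fun N ↦ f 0 * ∏ j ∈ Finset.range N, (f (j + 1) * f (-(j + 1)))) atTop (𝓝 a) := by
  refine (h.comp Finset.tendsto_Icc_neg).congr fun N ↦ ?_
  induction N with
  | zero => simp
  | succ n ih =>
    rw [Finset.prod_range_succ, ← mul_assoc, ← ih]
    simp only [Function.comp_apply, Nat.cast_add, Nat.cast_one]
    rw [Finset.Icc_succ_succ, Finset.prod_union (by simp), Finset.prod_pair (by lia),
      mul_comm (f _)]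

lemma int_add_ne_zero {a : ℂ} (ha : a.im ≠ 0) (m : ℤ) : (m : ℂ) + a ≠ 0 := fun h ↦ ha <| by
  simpa using congrArg Complex.im h

lemma sin_pi_mul_ne_zero_of_im_ne_zero {a : ℂ} (ha : a.im ≠ 0) : Complex.sin (Real.pi * a) ≠ 0 := by
  rw [Complex.sin_ne_zero_iff]
  intro k hk
  rw [mul_comm, mul_left_inj' (by simp [Real.pi_ne_zero])] at hk
  exact ha (by simp [hk])

lemma summable_sq_div_int_add (a z : ℂ) : Summable fun m : ℤ ↦ (z / ((m : ℂ) + a)) ^ 2 := by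
  refine ((EisensteinSeries.linear_right_summable a 1 le_rfl).mul_left (z ^ 2)).congr fun m ↦ ?_
  rw [div_pow, div_eq_mul_inv]
  norm_num [add_comm]

lemma multipliable_one_sub_sq_div_int_add (a z : ℂ) :
    Multipliable fun m : ℤ ↦ 1 - (z / ((m : ℂ) + a)) ^ 2 := by
  simp only [sub_eq_add_neg]
  refine multipliable_one_add_of_summable ?_
  simpa only [norm_neg] using (summable_sq_div_int_add a z).norm

lemma hasProd_one_sub_sq_div_int_add {a : ℂ} (ha : a.im ≠ 0) (z : ℂ) :
    HasProd (fun m : ℤ ↦ 1 - (z / ((m : ℂ) + a)) ^ 2)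
      (Complex.sin (Real.pi * (a - z)) * Complex.sin (Real.pi * (a + z)) /
        Complex.sin (Real.pi * a) ^ 2) := by
  have h := (multipliable_one_sub_sq_div_int_add a z).hasProd
  have h1 := (((Complex.tendsto_euler_sin_prod (a - z)).mul
    (Complex.tendsto_euler_sin_prod (a + z))).div
    ((Complex.tendsto_euler_sin_prod a).pow 2)
    (pow_ne_zero 2 (sin_pi_mul_ne_zero_of_im_ne_zero ha)))
  have key := tendsto_nhds_unique h.tendsto_int_symm (h1.congr fun N ↦ ?_)
  · rwa [key] at h
  · have ha0 : a ≠ 0 := by simpa using int_add_ne_zero ha 0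
    have hπ : (Real.pi : ℂ) ≠ 0 := Complex.ofReal_ne_zero.mpr Real.pi_ne_zero
    have e (j : ℕ) : (1 - (z / (((j + 1 : ℤ) : ℂ) + a)) ^ 2) *
        (1 - (z / (((-(j + 1) : ℤ) : ℂ) + a)) ^ 2) =
        (1 - (a - z) ^ 2 / ((j : ℂ) + 1) ^ 2) * (1 - (a + z) ^ 2 / ((j : ℂ) + 1) ^ 2) /
          (1 - a ^ 2 / ((j : ℂ) + 1) ^ 2) ^ 2 := by
      have h1 := int_add_ne_zero ha (j + 1)
      have h2 := int_add_ne_zero ha (-(j + 1))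
      have h3 : (j : ℂ) + 1 ≠ 0 := Nat.cast_add_one_ne_zero j
      push_cast at h1 h2 ⊢
      have h4 : 1 - a ^ 2 / ((j : ℂ) + 1) ^ 2 =
        -((j + 1 + a) * (-(j + 1) + a)) / ((j : ℂ) + 1) ^ 2 := by
        field_simp
        ring
      rw [h4]
      field_simp
      ring
    simp only [e, Pi.div_apply, Finset.prod_div_distrib, Finset.prod_mul_distrib, Finset.prod_pow]
    rw [Int.cast_zero, zero_add]
    field_simp
    ring

lemma summable_one_div_nat_succ_sq : Summable fun j : ℕ ↦ 1 / ((j : ℂ) + 1) ^ 2 := by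
  have := (summable_nat_add_iff 1).mpr
    ((Complex.summable_one_div_nat_cpow (p := 2)).mpr (by simp))
  simpa using this

lemma mul_row_zero {z P : ℂ} (h : HasProd (fun m : ℤ ↦ elemFactor (z / m)) P) :
    z * P = Complex.sin (Real.pi * z) / Real.pi *
      Complex.exp (z ^ 2 * ∑' j : ℕ, 1 / ((j : ℂ) + 1) ^ 2) := by
  have hπ : (Real.pi : ℂ) ≠ 0 := Complex.ofReal_ne_zero.mpr Real.pi_ne_zero
  have hs := summable_one_div_nat_succ_sq
  have h1 := ((Complex.tendsto_euler_sin_prod z).div_const (Real.pi : ℂ)).mul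
    (hs.hasSum.mul_left (z ^ 2)).cexp.tendsto_prod_nat
  refine tendsto_nhds_unique (h.tendsto_int_symm.const_mul z) (h1.congr fun N ↦ ?_)
  have e (j : ℕ) : elemFactor (z / ((j + 1 : ℤ) : ℂ)) * elemFactor (z / ((-(j + 1) : ℤ) : ℂ)) =
      (1 - z ^ 2 / ((j : ℂ) + 1) ^ 2) * Complex.exp (z ^ 2 * (1 / ((j : ℂ) + 1) ^ 2)) := by
    rw [Int.cast_neg, div_neg, elemFactor_mul_neg]
    push_cast
    rw [div_pow, mul_one_div]
  simp only [e, Finset.prod_mul_distrib, Int.cast_zero, div_zero, elemFactor_zero, one_mul,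
    Function.comp_apply]
  field_simp

lemma row_mul_row_neg {a z P P' : ℂ} (ha : a.im ≠ 0)
    (h : HasProd (fun m : ℤ ↦ elemFactor (z / (m + a))) P)
    (h' : HasProd (fun m : ℤ ↦ elemFactor (z / (m + -a))) P') :
    P * P' = Complex.sin (Real.pi * (a - z)) * Complex.sin (Real.pi * (a + z)) /
        Complex.sin (Real.pi * a) ^ 2 *
      Complex.exp (z ^ 2 * ∑' m : ℤ, 1 / ((m : ℂ) + a) ^ 2) := by
  have hs := (summable_sq_div_int_add a z).hasSum
  have e : ∑' m : ℤ, (z / ((m : ℂ) + a)) ^ 2 = z ^ 2 * ∑' m : ℤ, 1 / ((m : ℂ) + a) ^ 2 := by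
    rw [← tsum_mul_left]
    exact tsum_congr fun m ↦ by rw [div_pow, mul_one_div]
  rw [e] at hs
  refine (h.mul ((Equiv.neg ℤ).hasProd_iff.mpr h')).unique
    (((hasProd_one_sub_sq_div_int_add ha z).mul hs.cexp).congr_fun fun m ↦ ?_)
  rw [Function.comp_apply, Equiv.neg_apply, Int.cast_neg, ← neg_add, div_neg, elemFactor_mul_neg]
  rfl

lemma sin_mul_sin_div_sin_sq {a : ℂ} (ha : a.im ≠ 0) (z : ℂ) :
    Complex.sin (Real.pi * (a - z)) * Complex.sin (Real.pi * (a + z)) /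
        Complex.sin (Real.pi * a) ^ 2 =
      (1 - Complex.exp (2 * Real.pi * Complex.I * a) * Complex.exp (2 * Real.pi * Complex.I * z)) *
        (1 - Complex.exp (2 * Real.pi * Complex.I * a) *
          (Complex.exp (2 * Real.pi * Complex.I * z))⁻¹) /
        (1 - Complex.exp (2 * Real.pi * Complex.I * a)) ^ 2 := by
  have hsin (x : ℂ) : Complex.sin (Real.pi * x) = Complex.I / 2 *
      Complex.exp (-(Real.pi * Complex.I * x)) *
        (1 - Complex.exp (2 * Real.pi * Complex.I * x)) := by
    rw [Complex.sin, mul_sub, mul_assoc _ _ (Complex.exp (2 * Real.pi * Complex.I * x)),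
      ← Complex.exp_add]
    ring_nf
  have hne := sin_pi_mul_ne_zero_of_im_ne_zero ha
  rw [hsin a] at hne ⊢
  rw [hsin, hsin, ← Complex.exp_neg, ← Complex.exp_add, ← Complex.exp_add,
    show 2 * Real.pi * Complex.I * (a - z) = 2 * Real.pi * Complex.I * a +
      -(2 * Real.pi * Complex.I * z) by ring, ← mul_add, div_eq_div_iff (pow_ne_zero 2 hne)
      (pow_ne_zero 2 (right_ne_zero_of_mul hne))]
  have h : Complex.exp (-(Real.pi * Complex.I * (a - z))) *
      Complex.exp (-(Real.pi * Complex.I * (a + z))) =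
      Complex.exp (-(Real.pi * Complex.I * a)) ^ 2 := by
    rw [sq, ← Complex.exp_add, ← Complex.exp_add]
    ring_nf
  linear_combination (Complex.I / 2) ^ 2 * (1 - Complex.exp (2 * Real.pi * Complex.I * a +
      -(2 * Real.pi * Complex.I * z))) * (1 - Complex.exp (2 * Real.pi * Complex.I * (a + z))) *
      (1 - Complex.exp (2 * Real.pi * Complex.I * a)) ^ 2 * h

lemma tsum_one_div_int_add_sq {a : ℂ} (ha : 0 < a.im) :
    ∑' m : ℤ, 1 / ((m : ℂ) + a) ^ 2 = (-2 * Real.pi * Complex.I) ^ 2 *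
      (Complex.exp (2 * Real.pi * Complex.I * a) /
        (1 - Complex.exp (2 * Real.pi * Complex.I * a)) ^ 2) := by
  have h := EisensteinSeries.qExpansion_identity le_rfl ⟨a, ha⟩
  simp only [pow_one, one_add_one_eq_two, Nat.factorial_one, Nat.cast_one, div_one] at h
  rw [tsum_coe_mul_geometric_of_norm_lt_one (norm_nome_sq_lt_one ha)] at h
  simpa only [add_comm] using h

lemma exp_nat_succ_mul (n : ℕ) (τ : ℂ) :
    Complex.exp (2 * Real.pi * Complex.I * (((n : ℂ) + 1) * τ)) =
      Complex.exp (2 * Real.pi * Complex.I * τ) ^ (n + 1) := by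
  rw [← Complex.exp_nat_mul]
  push_cast
  ring_nf

lemma nat_succ_mul_im_pos {τ : ℂ} (hτ : 0 < τ.im) (n : ℕ) : 0 < (((n : ℂ) + 1) * τ).im := by
  have : (((n : ℂ) + 1) * τ).im = (n + 1) * τ.im := by simp
  rw [this]
  positivity

/-- The sum of the inverse squares over the `(n + 1)`-st row of the lattice. -/
noncomputable def rowSum (τ : ℂ) (n : ℕ) : ℂ := ∑' m : ℤ, 1 / ((m : ℂ) + ((n : ℂ) + 1) * τ) ^ 2

lemma summable_rowSum {τ : ℂ} (hτ : 0 < τ.im) : Summable (rowSum τ) := by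
  have hQ := norm_nome_sq_lt_one hτ
  set Q := Complex.exp (2 * Real.pi * Complex.I * τ) with hQ_def
  have e : rowSum τ = fun n ↦ (-2 * Real.pi * Complex.I) ^ 2 *
      (Q ^ (n + 1) / (1 - Q ^ (n + 1)) ^ 2) := by
    funext n
    rw [rowSum, tsum_one_div_int_add_sq (nat_succ_mul_im_pos hτ n), exp_nat_succ_mul]
  rw [e]
  refine Summable.mul_left _ (.of_norm_bounded ((summable_norm_neg_pow_succ hQ).mul_right
    (((1 - ‖Q‖) ^ 2)⁻¹)) fun n ↦ ?_)
  rw [norm_div, norm_pow (1 - _), norm_neg, div_eq_mul_inv]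
  have h1 : 0 < 1 - ‖Q‖ := sub_pos.mpr hQ
  have h2 : 1 - ‖Q‖ ≤ ‖1 - Q ^ (n + 1)‖ := by
    have h3 : ‖Q ^ (n + 1)‖ ≤ ‖Q‖ := by
      rw [norm_pow]
      exact pow_le_of_le_one (norm_nonneg _) hQ.le n.succ_ne_zero
    have := norm_sub_norm_le 1 (Q ^ (n + 1))
    rw [norm_one] at this
    linarith
  gcongr

lemma delta2_eq {τ : ℂ} (hτ : 0 < τ.im) :
    delta2 τ = 2 * ∑' j : ℕ, 1 / ((j : ℂ) + 1) ^ 2 + 2 * ∑' n, rowSum τ n := by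
  have hs := summable_one_div_nat_succ_sq
  set f : ℤ → ℂ := fun n ↦ ∑' m : ℤ,
    if (m, n) = ((0 : ℤ), (0 : ℤ)) then 0 else 1 / ((m : ℂ) + (n : ℂ) * τ) ^ 2 with hf
  have h1 (n : ℕ) : f (n + 1) = rowSum τ n := by
    have : (n : ℤ) + 1 ≠ 0 := by lia
    simp [hf, rowSum, this]
  have h2 (n : ℕ) : f (-(n + 1)) = rowSum τ n := by
    have : -((n : ℤ) + 1) ≠ 0 := by lia
    rw [hf, rowSum, ← (Equiv.neg ℤ).tsum_eq]
    refine tsum_congr fun m ↦ ?_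
    rw [if_neg fun h ↦ this (Prod.ext_iff.mp h).2]
    push_cast [Equiv.neg_apply]
    congr 1
    ring
  have h0 : f 0 = 2 * ∑' j : ℕ, 1 / ((j : ℂ) + 1) ^ 2 := by
    set g : ℤ → ℂ := fun m ↦ if (m, (0 : ℤ)) = ((0 : ℤ), (0 : ℤ)) then 0 else
      1 / ((m : ℂ) + ((0 : ℤ) : ℂ) * τ) ^ 2 with hg
    have e0 : g 0 = 0 := if_pos rfl
    have e1 (n : ℕ) : g (n + 1) = 1 / ((n : ℂ) + 1) ^ 2 := by
      have : (n : ℤ) + 1 ≠ 0 := by lia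
      rw [hg]
      simp [this]
    have e2 (n : ℕ) : g (-(n + 1)) = 1 / ((n : ℂ) + 1) ^ 2 := by
      have : -((n : ℤ) + 1) ≠ 0 := by lia
      rw [hg]
      dsimp only
      rw [if_neg fun h ↦ this (Prod.ext_iff.mp h).1, Int.cast_zero, zero_mul, add_zero,
        Int.cast_neg, neg_sq]
      push_cast
      rfl
    change ∑' m, g m = _
    rw [tsum_of_add_one_of_neg_add_one (by simpa only [e1] using hs)
      (by simpa only [e2] using hs)]
    simp only [e0, e1, e2]
    ring
  change ∑' n, f n = _
  have hr := summable_rowSum hτ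
  rw [tsum_of_add_one_of_neg_add_one (by simpa only [h1] using hr) (by simpa only [h2] using hr)]
  simp only [h1, h2]
  rw [h0]
  ring

lemma wSigma_eq {τ : ℂ} (hτ : 0 < τ.im) (z : ℂ) :
    wSigma 1 τ z = Complex.exp (z ^ 2 / 2 * delta2 τ) * (Complex.sin (Real.pi * z) / Real.pi *
      (thetaProd (Complex.exp (2 * Real.pi * Complex.I * τ))
        (Complex.exp (2 * Real.pi * Complex.I * z)) /
        qPochInf (Complex.exp (2 * Real.pi * Complex.I * τ)) ^ 2)) := by
  have hQ := norm_nome_sq_lt_one hτ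
  set Q := Complex.exp (2 * Real.pi * Complex.I * τ) with hQ_def
  set w := Complex.exp (2 * Real.pi * Complex.I * z) with hw_def
  have hE := summable_norm_elemFactor_sub_one (summable_norm_div_lattice_pow_three hτ z)
  have hM := multipliable_one_add_of_summable hE
  have hR (n : ℤ) := (multipliable_one_add_of_summable
    (hE.comp_injective (Prod.mk_right_injective n))).hasProd
  simp only [add_sub_cancel] at hM hR
  have hrow := hM.hasProd.prod_fiberwise hR
  set P := ∏' p : ℤ × ℤ, elemFactor (z / ((p.2 : ℂ) + p.1 * τ)) with hP
  set R : ℤ → ℂ := fun n ↦ ∏' m : ℤ, elemFactor (z / ((m : ℂ) + n * τ)) with hR_def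
  have hσ : wSigma 1 τ z = z * P := by
    have hc : P = ∏' p : ℤ × ℤ, elemFactor (z / ((p.1 : ℂ) * 1 + p.2 * τ)) := by
      rw [hP, ← (Equiv.prodComm ℤ ℤ).tprod_eq]
      simp
    have hsub := tprod_subtype_eq_of_mulSupport_subset (s := {p : ℤ × ℤ | p ≠ 0})
      (f := fun p : ℤ × ℤ ↦ elemFactor (z / ((p.1 : ℂ) * 1 + p.2 * τ)))
      fun p hp hp0 ↦ hp (by simp [hp0, elemFactor_zero])
    rw [wSigma, hc, ← hsub]
    congr 1
    refine tprod_congr fun p ↦ ?_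
    rw [elemFactor, div_pow, div_div, mul_comm (_ ^ 2) 2]
  have hpair (n : ℕ) : R (n + 1) * R (-(n + 1)) =
      (1 - Q ^ (n + 1) * w) * (1 - Q ^ (n + 1) * w⁻¹) / (1 - Q ^ (n + 1)) ^ 2 *
        Complex.exp (z ^ 2 * rowSum τ n) := by
    have ha := (nat_succ_mul_im_pos hτ n).ne'
    have hR1 := hR (n + 1)
    have hR2 := hR (-(n + 1))
    push_cast at hR1 hR2
    simp only [neg_mul] at hR2
    have := row_mul_row_neg ha hR1 hR2
    rw [sin_mul_sin_div_sin_sq ha, exp_nat_succ_mul] at this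
    have e (m : ℤ) : (m : ℂ) + ((-(n + 1) : ℤ) : ℂ) * τ = m + -((n + 1) * τ) := by
      push_cast
      ring
    simp only [hR_def, e]
    push_cast
    exact this
  have hzero : z * R 0 = Complex.sin (Real.pi * z) / Real.pi *
      Complex.exp (z ^ 2 * ∑' j : ℕ, 1 / ((j : ℂ) + 1) ^ 2) :=
    mul_row_zero (by simpa [hR_def] using hR 0)
  have hθ : Tendsto (fun N ↦ ∏ n ∈ Finset.range N, ((1 - Q ^ (n + 1) * w) *
      (1 - Q ^ (n + 1) * w⁻¹))) atTop (𝓝 (thetaProd Q w)) :=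
    ((multipliable_one_sub_pow_mul hQ w).mul
      (multipliable_one_sub_pow_mul hQ w⁻¹)).hasProd.tendsto_prod_nat
  have hlim := (((hθ.div ((tendsto_qPoch hQ).pow 2) (pow_ne_zero 2 (qPochInf_ne_zero hQ))).mul
    ((summable_rowSum hτ).hasSum.mul_left (z ^ 2)).cexp.tendsto_prod_nat).const_mul (z * R 0))
  rw [hσ, tendsto_nhds_unique (hrow.tendsto_int_symm.const_mul z) (hlim.congr fun N ↦ ?_), hzero,
    delta2_eq hτ, mul_add, Complex.exp_add]
  · ring_nf
  · simp only [hpair, Finset.prod_mul_distrib, Finset.prod_div_distrib, Finset.prod_pow, qPoch,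
      Pi.div_apply, Function.comp_apply]
    ring

end

/-- σ(z, τ) = exp((z²/2)·δ₂(τ)) · θ₁(πz|τ) / (π·θ₁′(0|τ)) for the lattice Λ = ℤ + τℤ. -/
theorem sigma_eq_theta (τ : ℂ) (hτ : 0 < τ.im) (z : ℂ) :
    wSigma 1 τ z =
      Complex.exp (z ^ 2 / 2 * delta2 τ) * theta1 ((Real.pi : ℂ) * z) τ /
        ((Real.pi : ℂ) * theta1deriv τ) := by
  have hπ : (Real.pi : ℂ) ≠ 0 := Complex.ofReal_ne_zero.mpr Real.pi_ne_zero
  have hq := qPochInf_ne_zero (norm_nome_sq_lt_one hτ)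
  have he := Complex.exp_ne_zero (Real.pi * Complex.I * τ / 4)
  rw [wSigma_eq hτ, theta1_eq_prod hτ, theta1deriv_eq hτ]
  field_simp
end

section
/- Let ω₁, ω₂ ∈ ℂ with Im(ω₂/ω₁) > 0, set τ = ω₂/ω₁, q = exp(iπτ), and Λ = {2mω₁ + 2nω₂ : m, n ∈ ℤ}. Set e₁ = ℘(ω₁|Λ). Then for every z ∉ Λ, ℘(z|Λ) − e₁ = (π·θ₃(0|τ)·θ₄(0|τ)/(2ω₁))² · θ₂(πz/(2ω₁)|τ)² / θ₁(πz/(2ω₁)|τ)². -/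
/-- Jacobi theta function θ₂(z|τ). -/
noncomputable def theta2 (z τ : ℂ) : ℂ :=
  2 * ∑' n : ℕ, Complex.exp (Real.pi * Complex.I * τ * ((n : ℂ) + 1 / 2) ^ 2) *
      Complex.cos ((2 * (n : ℂ) + 1) * z)

/-- Jacobi theta function θ₃(z|τ). -/
noncomputable def theta3 (z τ : ℂ) : ℂ :=
  1 + 2 * ∑' n : ℕ, Complex.exp (Real.pi * Complex.I * τ * ((n : ℂ) + 1) ^ 2) *
      Complex.cos (2 * ((n : ℂ) + 1) * z)

/-- Jacobi theta function θ₄(z|τ). -/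
noncomputable def theta4 (z τ : ℂ) : ℂ :=
  1 + 2 * ∑' n : ℕ, (-1) ^ (n + 1) * Complex.exp (Real.pi * Complex.I * τ * ((n : ℂ) + 1) ^ 2) *
      Complex.cos (2 * ((n : ℂ) + 1) * z)

/-- Weierstrass ℘-function for the lattice ℤ·g₁ + ℤ·g₂. -/
noncomputable def wp (g1 g2 z : ℂ) : ℂ :=
  1 / z ^ 2 + ∑' p : {p : ℤ × ℤ // p ≠ 0},
      (1 / (z - ((p.1.1 : ℂ) * g1 + (p.1.2 : ℂ) * g2)) ^ 2 -
        1 / ((p.1.1 : ℂ) * g1 + (p.1.2 : ℂ) * g2) ^ 2)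

section

open Complex Filter Topology

theorem jacobiTheta₂_half_add_half_eq_zero (τ : ℂ) : jacobiTheta₂ (1 / 2 + τ / 2) τ = 0 := by
  have h₁ : jacobiTheta₂ (1 / 2 + τ / 2) τ = jacobiTheta₂ (1 / 2 - τ / 2) τ := by
    rw [← jacobiTheta₂_neg_left, ← jacobiTheta₂_add_left]
    ring_nf
  have h₂ := jacobiTheta₂_add_left' (1 / 2 - τ / 2) τ
  have h₃ : -Real.pi * I * (τ + 2 * (1 / 2 - τ / 2)) = -(Real.pi * I) := by ring
  rw [h₃, Complex.exp_neg, exp_pi_mul_I, ← h₁,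
    show 1 / 2 - τ / 2 + τ = 1 / 2 + τ / 2 by ring] at h₂
  linear_combination h₂ / 2

/-- The bijection `(r, s, ε) ↦ (r + s + ε, r - s)`, splitting pairs of integers by the parity of
their sum. -/
def intProdParityEquiv : (ℤ × ℤ) ⊕ (ℤ × ℤ) ≃ ℤ × ℤ where
  toFun := Sum.elim (fun p ↦ (p.1 + p.2, p.1 - p.2)) (fun p ↦ (p.1 + p.2 + 1, p.1 - p.2))
  invFun p := if (p.1 + p.2) % 2 = 0 then Sum.inl ((p.1 + p.2) / 2, (p.1 - p.2) / 2)
    else Sum.inr ((p.1 + p.2 - 1) / 2, (p.1 - p.2 - 1) / 2)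
  left_inv := by
    rintro (⟨r, s⟩ | ⟨r, s⟩)
    · change (if (r + s + (r - s)) % 2 = 0 then _ else _) = _
      refine (if_pos (by omega)).trans (congrArg Sum.inl (Prod.ext ?_ ?_)) <;> dsimp <;> omega
    · change (if (r + s + 1 + (r - s)) % 2 = 0 then _ else _) = _
      refine (if_neg (by omega)).trans (congrArg Sum.inr (Prod.ext ?_ ?_)) <;> dsimp <;> omega
  right_inv := by
    rintro ⟨m, n⟩
    dsimp only
    split_ifs with h
    · simp only [Sum.elim_inl, Prod.mk.injEq]
      omega
    · simp only [Sum.elim_inr, Prod.mk.injEq]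
      omega

theorem jacobiTheta₂_mul_hasSum (x y : ℂ) {τ : ℂ} (hτ : 0 < τ.im) :
    HasSum (fun p : ℤ × ℤ ↦ jacobiTheta₂_term p.1 x τ * jacobiTheta₂_term p.2 y τ)
      (jacobiTheta₂ x τ * jacobiTheta₂ y τ) := by
  have hx := (summable_jacobiTheta₂_term_iff x τ).2 hτ
  have hy := (summable_jacobiTheta₂_term_iff y τ).2 hτ
  rw [jacobiTheta₂, jacobiTheta₂, tsum_mul_tsum_of_summable_norm hx.norm hy.norm]
  exact (summable_mul_of_summable_norm hx.norm hy.norm).hasSum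

/-- The product formula expressing theta functions of modulus `τ` by those of modulus `2 * τ`. -/
theorem jacobiTheta₂_mul (x y : ℂ) {τ : ℂ} (hτ : 0 < τ.im) :
    jacobiTheta₂ x τ * jacobiTheta₂ y τ =
      jacobiTheta₂ (x + y) (2 * τ) * jacobiTheta₂ (x - y) (2 * τ) +
      cexp (Real.pi * I * (τ + 2 * x)) *
        (jacobiTheta₂ (x + y + τ) (2 * τ) * jacobiTheta₂ (x - y + τ) (2 * τ)) := by
  have hτ' : 0 < (2 * τ).im := by simpa using hτ
  have h := (intProdParityEquiv.hasSum_iff).2 (jacobiTheta₂_mul_hasSum x y hτ)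
  refine h.unique (HasSum.sum ?_ ?_)
  · refine (jacobiTheta₂_mul_hasSum (x + y) (x - y) hτ').congr_fun fun p ↦ ?_
    simp only [jacobiTheta₂_term, intProdParityEquiv, Function.comp, Equiv.coe_fn_mk,
      Sum.elim_inl, ← Complex.exp_add]
    push_cast
    ring_nf
  · refine
      ((jacobiTheta₂_mul_hasSum (x + y + τ) (x - y + τ) hτ').mul_left _).congr_fun fun p ↦ ?_
    simp only [jacobiTheta₂_term, intProdParityEquiv, Function.comp, Equiv.coe_fn_mk,
      Sum.elim_inr, ← Complex.exp_add]
    push_cast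
    ring_nf

theorem jacobiTheta₂_zero_mul_half {τ : ℂ} (hτ : 0 < τ.im) :
    jacobiTheta₂ 0 τ * jacobiTheta₂ (1 / 2) τ = jacobiTheta₂ (1 / 2) (2 * τ) ^ 2 := by
  have h := jacobiTheta₂_half_add_half_eq_zero (2 * τ)
  rw [show 1 / 2 + 2 * τ / 2 = 1 / 2 + τ by ring] at h
  rw [jacobiTheta₂_mul _ _ hτ, zero_add, h, zero_sub, jacobiTheta₂_neg_left]
  ring

theorem jacobiTheta₂_half_period_sq {τ : ℂ} (hτ : 0 < τ.im) :
    jacobiTheta₂ (τ / 2) τ ^ 2 =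
      2 * jacobiTheta₂ (2 * τ / 2) (2 * τ) * jacobiTheta₂ 0 (2 * τ) := by
  have h := jacobiTheta₂_add_left' 0 (2 * τ)
  rw [sq, jacobiTheta₂_mul _ _ hτ, show τ / 2 + τ / 2 + τ = 0 + 2 * τ by ring, h,
    show τ / 2 + τ / 2 = 2 * τ / 2 by ring, sub_self, zero_add,
    show 2 * τ / 2 = τ by ring]
  have : cexp (Real.pi * I * (τ + 2 * (τ / 2))) * cexp (-Real.pi * I * (2 * τ + 2 * 0)) = 1 := by
    rw [← Complex.exp_add, Complex.exp_eq_one_iff]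
    exact ⟨0, by push_cast; ring⟩
  linear_combination (jacobiTheta₂ 0 (2 * τ) * jacobiTheta₂ τ (2 * τ)) * this

theorem jacobiTheta₂'_mul_half_period {τ : ℂ} (hτ : 0 < τ.im) :
    jacobiTheta₂' (1 / 2 + τ / 2) τ * jacobiTheta₂ (τ / 2) τ =
      2 * jacobiTheta₂' (1 / 2 + 2 * τ / 2) (2 * τ) * jacobiTheta₂ (1 / 2) (2 * τ) := by
  have hτ' : 0 < (2 * τ).im := by simpa using hτ
  have h0 := jacobiTheta₂_half_add_half_eq_zero (2 * τ)
  have key (z : ℂ) : jacobiTheta₂ (z + (1 / 2 + τ / 2)) τ * jacobiTheta₂ (z + τ / 2) τ =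
      jacobiTheta₂ (2 * z + (1 / 2 + 2 * τ / 2)) (2 * τ) * jacobiTheta₂ (1 / 2) (2 * τ) := by
    rw [jacobiTheta₂_mul _ _ hτ,
      show z + (1 / 2 + τ / 2) - (z + τ / 2) + τ = 1 / 2 + 2 * τ / 2 by ring, h0]
    ring_nf
  have d₁ : HasDerivAt (fun z ↦ jacobiTheta₂ (z + (1 / 2 + τ / 2)) τ * jacobiTheta₂ (z + τ / 2) τ)
      (jacobiTheta₂' (0 + (1 / 2 + τ / 2)) τ * jacobiTheta₂ (0 + τ / 2) τ +
        jacobiTheta₂ (0 + (1 / 2 + τ / 2)) τ * jacobiTheta₂' (0 + τ / 2) τ) 0 :=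
    ((hasDerivAt_jacobiTheta₂_fst _ hτ).comp_add_const 0 _).mul
      ((hasDerivAt_jacobiTheta₂_fst _ hτ).comp_add_const 0 _)
  have d₂ : HasDerivAt (fun z ↦ jacobiTheta₂ (2 * z + (1 / 2 + 2 * τ / 2)) (2 * τ) *
      jacobiTheta₂ (1 / 2) (2 * τ))
      (jacobiTheta₂' (2 * 0 + (1 / 2 + 2 * τ / 2)) (2 * τ) * 2 *
        jacobiTheta₂ (1 / 2) (2 * τ)) 0 := by
    refine (HasDerivAt.comp 0 (hasDerivAt_jacobiTheta₂_fst _ hτ') ?_).mul_const _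
    simpa using ((hasDerivAt_id (0 : ℂ)).const_mul 2).add_const (1 / 2 + 2 * τ / 2)
  rw [← funext key] at d₂
  have := d₁.unique d₂
  rw [mul_zero, zero_add, zero_add, zero_add, jacobiTheta₂_half_add_half_eq_zero] at this
  linear_combination this

theorem tendsto_tsum_exp_mul_two_pow {a : ℤ → ℂ} {k : ℤ → ℤ} (hk : ∀ n, 0 ≤ k n) {τ : ℂ}
    (hτ : 0 < τ.im)
    (hs : Summable fun n ↦ a n * cexp (Real.pi * I * k n * τ)) :
    Tendsto (fun j : ℕ ↦ ∑' n, a n * cexp (Real.pi * I * k n * (2 ^ j * τ))) atTop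
      (𝓝 (∑' n, if k n = 0 then a n else 0)) := by
  have hnorm (n : ℤ) (j : ℕ) : ‖cexp (Real.pi * I * k n * (2 ^ j * τ))‖ =
      Real.exp (-(Real.pi * k n * τ.im) * 2 ^ j) := by
    rw [Complex.norm_exp]
    congr 1
    have : (Real.pi * I * k n * (2 ^ j * τ) : ℂ) = ((Real.pi * k n * 2 ^ j : ℝ) : ℂ) * (I * τ) := by
      push_cast
      ring
    rw [this, Complex.re_ofReal_mul]
    simp
    ring
  have hnonneg (n : ℤ) : 0 ≤ Real.pi * k n * τ.im := by
    have : (0 : ℝ) ≤ k n := mod_cast hk n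
    positivity
  refine tendsto_tsum_of_dominated_convergence hs.norm (fun n ↦ ?_) (Eventually.of_forall ?_)
  · split_ifs with h
    · simp [h]
    · rw [tendsto_zero_iff_norm_tendsto_zero]
      simp_rw [norm_mul, hnorm]
      rw [← mul_zero ‖a n‖]
      refine (Real.tendsto_exp_atBot.comp ?_).const_mul _
      refine (tendsto_pow_atTop_atTop_of_one_lt one_lt_two).const_mul_atTop_of_neg ?_
      have : (0 : ℝ) < k n := mod_cast (hk n).lt_of_ne' h
      have : 0 < Real.pi * k n * τ.im := by positivity
      linarith
  · intro j n
    have h0 := hnorm n 0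
    rw [pow_zero, one_mul] at h0
    rw [norm_mul, norm_mul, hnorm, h0]
    gcongr 1
    rw [Real.exp_le_exp]
    nlinarith [one_le_pow₀ one_le_two (n := j) (M₀ := ℝ), hnonneg n]

theorem tendsto_jacobiTheta₂_zero {τ : ℂ} (hτ : 0 < τ.im) :
    Tendsto (fun j : ℕ ↦ jacobiTheta₂ 0 (2 ^ j * τ)) atTop (𝓝 1) := by
  have hs := (summable_jacobiTheta₂_term_iff 0 τ).2 hτ
  have e (n : ℤ) (σ : ℂ) : jacobiTheta₂_term n 0 σ =
      1 * cexp (Real.pi * I * (n ^ 2 : ℤ) * σ) := by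
    simp [jacobiTheta₂_term]
  simp_rw [e] at hs
  have := tendsto_tsum_exp_mul_two_pow (fun n ↦ sq_nonneg n) hτ hs
  simpa [jacobiTheta₂, e] using this

theorem tendsto_jacobiTheta₂_half {τ : ℂ} (hτ : 0 < τ.im) :
    Tendsto (fun j : ℕ ↦ jacobiTheta₂ (1 / 2) (2 ^ j * τ)) atTop (𝓝 1) := by
  have hs := (summable_jacobiTheta₂_term_iff (1 / 2) τ).2 hτ
  have e (n : ℤ) (σ : ℂ) : jacobiTheta₂_term n (1 / 2) σ =
      cexp (Real.pi * I * n) * cexp (Real.pi * I * (n ^ 2 : ℤ) * σ) := by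
    rw [jacobiTheta₂_term, ← Complex.exp_add]
    push_cast
    ring_nf
  simp_rw [e] at hs
  have := tendsto_tsum_exp_mul_two_pow (fun n ↦ sq_nonneg n) hτ hs
  rw [tsum_eq_single 0 (by simp +contextual)] at this
  simp_rw [jacobiTheta₂, e]
  simpa using this

theorem sq_add_self_nonneg (n : ℤ) : 0 ≤ n ^ 2 + n := by
  rcases le_or_gt 0 n with h | h
  · positivity
  · nlinarith

theorem tsum_ite_sq_add_self_eq_zero (a : ℤ → ℂ) :
    ∑' n : ℤ, (if n ^ 2 + n = 0 then a n else 0) = a 0 + a (-1) := by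
  rw [tsum_eq_sum (s := {0, -1})]
  · simp
  · intro n hn
    rw [if_neg]
    contrapose! hn
    have : n * (n + 1) = 0 := by linarith
    rcases mul_eq_zero.1 this with h | h
    · simp [h]
    · simp [show n = -1 by omega]

theorem tendsto_jacobiTheta₂_half_period {τ : ℂ} (hτ : 0 < τ.im) :
    Tendsto (fun j : ℕ ↦ jacobiTheta₂ (2 ^ j * τ / 2) (2 ^ j * τ)) atTop (𝓝 2) := by
  have hs := (summable_jacobiTheta₂_term_iff (τ / 2) τ).2 hτ
  have e (n : ℤ) (σ : ℂ) : jacobiTheta₂_term n (σ / 2) σ =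
      1 * cexp (Real.pi * I * (n ^ 2 + n : ℤ) * σ) := by
    rw [jacobiTheta₂_term]
    push_cast
    ring_nf
  simp_rw [e] at hs
  have := tendsto_tsum_exp_mul_two_pow sq_add_self_nonneg hτ hs
  rw [tsum_ite_sq_add_self_eq_zero] at this
  simpa [jacobiTheta₂, e, one_add_one_eq_two] using this

theorem tendsto_jacobiTheta₂'_half_add_half_period {τ : ℂ} (hτ : 0 < τ.im) :
    Tendsto (fun j : ℕ ↦ jacobiTheta₂' (1 / 2 + 2 ^ j * τ / 2) (2 ^ j * τ)) atTop
      (𝓝 (2 * Real.pi * I)) := by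
  have hs := (summable_jacobiTheta₂'_term_iff (1 / 2 + τ / 2) τ).2 hτ
  have e (n : ℤ) (σ : ℂ) : jacobiTheta₂'_term n (1 / 2 + σ / 2) σ =
      (2 * Real.pi * I * n * cexp (Real.pi * I * n)) *
        cexp (Real.pi * I * (n ^ 2 + n : ℤ) * σ) := by
    rw [jacobiTheta₂'_term, jacobiTheta₂_term, mul_assoc _ (cexp _), ← Complex.exp_add]
    push_cast
    ring_nf
  simp_rw [e] at hs
  have := tendsto_tsum_exp_mul_two_pow sq_add_self_nonneg hτ hs
  rw [tsum_ite_sq_add_self_eq_zero] at this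
  simp_rw [jacobiTheta₂', e]
  simpa [Complex.exp_neg] using this

theorem two_pow_mul_im_pos {τ : ℂ} (hτ : 0 < τ.im) (j : ℕ) : 0 < (2 ^ j * τ).im := by
  have : (2 ^ j * τ : ℂ) = ((2 ^ j : ℝ) : ℂ) * τ := by push_cast; rfl
  rw [this, Complex.im_ofReal_mul]
  positivity

theorem jacobiTheta₂_half_ne_zero {τ : ℂ} (hτ : 0 < τ.im) : jacobiTheta₂ (1 / 2) τ ≠ 0 := by
  intro h
  have hj (j : ℕ) : jacobiTheta₂ (1 / 2) (2 ^ j * τ) = 0 := by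
    induction j with
    | zero => simpa using h
    | succ j ih =>
      have := jacobiTheta₂_zero_mul_half (two_pow_mul_im_pos hτ j)
      rw [ih, mul_zero, ← mul_assoc, ← pow_succ'] at this
      exact pow_eq_zero_iff two_ne_zero |>.1 this.symm
  have := tendsto_jacobiTheta₂_half hτ
  simp_rw [hj] at this
  exact zero_ne_one (tendsto_nhds_unique tendsto_const_nhds this)

theorem jacobiTheta₂_zero_ne_zero {τ : ℂ} (hτ : 0 < τ.im) : jacobiTheta₂ 0 τ ≠ 0 := by
  intro h
  have := jacobiTheta₂_zero_mul_half hτ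
  rw [h, zero_mul] at this
  exact jacobiTheta₂_half_ne_zero (by simpa using hτ : 0 < (2 * τ).im)
    (pow_eq_zero_iff two_ne_zero |>.1 this.symm)

theorem jacobiTheta₂_half_period_ne_zero {τ : ℂ} (hτ : 0 < τ.im) :
    jacobiTheta₂ (τ / 2) τ ≠ 0 := by
  intro h
  have hj (j : ℕ) : jacobiTheta₂ (2 ^ j * τ / 2) (2 ^ j * τ) = 0 := by
    induction j with
    | zero => simpa using h
    | succ j ih =>
      have hσ := two_pow_mul_im_pos hτ j
      have := jacobiTheta₂_half_period_sq hσ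
      rw [ih, ← mul_assoc, ← pow_succ'] at this
      have h' := jacobiTheta₂_zero_ne_zero (two_pow_mul_im_pos hτ (j + 1))
      simpa [h'] using this.symm
  have := tendsto_jacobiTheta₂_half_period hτ
  simp_rw [hj] at this
  exact two_ne_zero (tendsto_nhds_unique tendsto_const_nhds this).symm

/-- Jacobi's derivative formula `θ₁' = π θ₂ θ₃ θ₄`, in terms of `jacobiTheta₂`. -/
theorem jacobiTheta₂'_half_add_half_period {τ : ℂ} (hτ : 0 < τ.im) :
    jacobiTheta₂' (1 / 2 + τ / 2) τ =
      Real.pi * I * (jacobiTheta₂ (τ / 2) τ * jacobiTheta₂ 0 τ * jacobiTheta₂ (1 / 2) τ) := by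
  let P (σ : ℂ) := jacobiTheta₂ (σ / 2) σ * jacobiTheta₂ 0 σ * jacobiTheta₂ (1 / 2) σ
  let R (σ : ℂ) := jacobiTheta₂' (1 / 2 + σ / 2) σ / P σ
  have hP {σ : ℂ} (hσ : 0 < σ.im) : P σ ≠ 0 :=
    mul_ne_zero (mul_ne_zero (jacobiTheta₂_half_period_ne_zero hσ) (jacobiTheta₂_zero_ne_zero hσ))
      (jacobiTheta₂_half_ne_zero hσ)
  have hR {σ : ℂ} (hσ : 0 < σ.im) : R (2 * σ) = R σ := by
    have hσ' : 0 < (2 * σ).im := by simpa using hσ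
    rw [div_eq_div_iff (hP hσ') (hP hσ)]
    refine mul_left_cancel₀ (jacobiTheta₂_half_period_ne_zero hσ) ?_
    have h₁ := jacobiTheta₂_zero_mul_half hσ
    have h₂ := jacobiTheta₂_half_period_sq hσ
    have h₃ := jacobiTheta₂'_mul_half_period hσ
    simp only [P]
    linear_combination (jacobiTheta₂' (1 / 2 + 2 * σ / 2) (2 * σ) *
        jacobiTheta₂ (σ / 2) σ ^ 2) * h₁ +
      (jacobiTheta₂' (1 / 2 + 2 * σ / 2) (2 * σ) * jacobiTheta₂ (1 / 2) (2 * σ) ^ 2) * h₂ -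
      (jacobiTheta₂ (2 * σ / 2) (2 * σ) * jacobiTheta₂ 0 (2 * σ) *
        jacobiTheta₂ (1 / 2) (2 * σ)) * h₃
  have hRj (j : ℕ) : R (2 ^ j * τ) = R τ := by
    induction j with
    | zero => simp
    | succ j ih => rw [pow_succ', mul_assoc, hR (two_pow_mul_im_pos hτ j), ih]
  have hlim : Tendsto (fun j : ℕ ↦ R (2 ^ j * τ)) atTop (𝓝 (2 * Real.pi * I / (2 * 1 * 1))) :=
    (tendsto_jacobiTheta₂'_half_add_half_period hτ).div
      (((tendsto_jacobiTheta₂_half_period hτ).mul (tendsto_jacobiTheta₂_zero hτ)).mul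
        (tendsto_jacobiTheta₂_half hτ)) (by norm_num)
  simp_rw [hRj] at hlim
  have h := tendsto_nhds_unique tendsto_const_nhds hlim
  rw [div_eq_iff (hP hτ)] at h
  rw [h]
  simp only [P]
  ring

theorem eq_zero_of_forall_fourier_integral_eq_zero {h : ℝ → ℂ} (hc : Continuous h)
    (hp : Function.Periodic h 1)
    (h0 : ∀ n : ℤ, ∫ x in (0 : ℝ)..1, cexp (-2 * Real.pi * I * n * x) * h x = 0) : h = 0 := by
  let F : C(AddCircle (1 : ℝ), ℂ) := ⟨hp.lift, hc.quotient_lift _⟩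
  have hF (n : ℤ) : fourierCoeff F n = 0 := by
    rw [fourierCoeff_eq_intervalIntegral _ n 0, zero_add, div_one, one_smul, ← h0 n]
    refine intervalIntegral.integral_congr fun x _ ↦ ?_
    have : F x = h x := hp.lift_coe x
    simp only [fourier_coe_apply, this, smul_eq_mul]
    congr 2
    push_cast
    ring
  have hs : Summable (fourierCoeff F) := by
    rw [funext hF]
    exact summable_zero
  funext x
  have := has_pointwise_sum_fourier_series_of_summable hs x
  simp_rw [hF, zero_smul] at this
  exact this.unique hasSum_zero

theorem integral_add_complex_of_periodic {g : ℂ → ℂ} (hg : Differentiable ℂ g)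
    (hp : Function.Periodic g 1) (w : ℂ) :
    ∫ x in (0 : ℝ)..1, g (x + w) = ∫ x in (0 : ℝ)..1, g x := by
  have hv : ∫ x in (0 : ℝ)..1, g (x + w.im * I) = ∫ x in (0 : ℝ)..1, g x := by
    have h := integral_boundary_rect_eq_zero_of_differentiableOn g 0 (1 + w.im * I)
      hg.differentiableOn
    have hside : ∀ y : ℝ, g (1 + y * I) = g (y * I) := fun y ↦ by rw [add_comm, hp]
    simp [hside] at h
    exact (sub_eq_zero.1 h).symm
  have hper : Function.Periodic (fun x : ℝ ↦ g (x + w.im * I)) 1 := fun x ↦ by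
    simp only [ofReal_add, ofReal_one, add_right_comm _ (1 : ℂ), hp _]
  have hu := hper.intervalIntegral_add_eq w.re 0
  rw [zero_add, hv] at hu
  have hshift := intervalIntegral.integral_comp_add_right (a := 0) (b := 1)
    (fun x : ℝ ↦ g (x + w.im * I)) w.re
  rw [zero_add, add_comm 1 w.re, hu] at hshift
  rw [← hshift]
  congr 1
  funext x
  rw [ofReal_add, add_assoc, re_add_im]

/-- Entire functions with the periodicity behaviour of products of two theta functions. -/
structure IsThetaDegreeTwo (τ : ℂ) (f : ℂ → ℂ) : Prop where
  differentiable : Differentiable ℂ f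
  add_one (z : ℂ) : f (z + 1) = f z
  add_period (z : ℂ) : f (z + τ) = cexp (-2 * Real.pi * I * (τ + 2 * z)) * f z

namespace IsThetaDegreeTwo

variable {τ : ℂ} {f g h : ℂ → ℂ}

/-- The Fourier coefficients of the restriction of `f` to the real line. -/
noncomputable def coeff (f : ℂ → ℂ) (n : ℤ) : ℂ :=
  ∫ x in (0 : ℝ)..1, cexp (-2 * Real.pi * I * n * x) * f x

theorem coeff_add_complex (hf : IsThetaDegreeTwo τ f) (n : ℤ) (w : ℂ) :
    ∫ x in (0 : ℝ)..1, cexp (-2 * Real.pi * I * n * (x + w)) * f (x + w) = coeff f n := by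
  refine integral_add_complex_of_periodic
    (g := fun z ↦ cexp (-2 * Real.pi * I * n * z) * f z) ?_ (fun z ↦ ?_) w
  · have := hf.differentiable
    fun_prop
  · dsimp only
    rw [hf.add_one]
    congr 1
    refine Complex.exp_eq_exp_iff_exists_int.2 ⟨-n, ?_⟩
    push_cast
    ring

theorem coeff_add_two (hf : IsThetaDegreeTwo τ f) (n : ℤ) :
    coeff f n = cexp (-2 * Real.pi * I * (n + 1) * τ) * coeff f (n + 2) := by
  rw [← hf.coeff_add_complex n τ, coeff, ← intervalIntegral.integral_const_mul]
  congr 1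
  funext x
  rw [hf.add_period, ← mul_assoc, ← mul_assoc, ← Complex.exp_add, ← Complex.exp_add]
  push_cast
  ring_nf

theorem eq_zero_of_coeff (hf : IsThetaDegreeTwo τ f) (h0 : coeff f 0 = 0) (h1 : coeff f 1 = 0) :
    f = 0 := by
  have hall (n : ℤ) : coeff f n = 0 ∧ coeff f (n + 1) = 0 := by
    induction n using Int.induction_on with
    | zero => exact ⟨h0, h1⟩
    | succ n ih =>
      refine ⟨ih.2, ?_⟩
      have := hf.coeff_add_two n
      rw [ih.1] at this
      simpa [add_assoc, one_add_one_eq_two] using this.symm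
    | pred n ih =>
      have := hf.coeff_add_two (-n - 1)
      rw [show (-n - 1 + 2 : ℤ) = -n + 1 by ring, ih.2, mul_zero] at this
      exact ⟨this, by simpa using ih.1⟩
  funext w
  have hcont := hf.differentiable.continuous
  have := eq_zero_of_forall_fourier_integral_eq_zero (h := fun x : ℝ ↦ f (x + w))
    (by fun_prop) (fun x ↦ by
      simp only [ofReal_add, ofReal_one, add_right_comm _ (1 : ℂ), hf.add_one]) fun n ↦ by
        have h := hf.coeff_add_complex n w
        rw [(hall n).1] at h
        rw [← mul_zero (cexp (2 * Real.pi * I * n * w)), ← h,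
          ← intervalIntegral.integral_const_mul]
        congr 1
        funext x
        rw [← mul_assoc, ← Complex.exp_add]
        ring_nf
  simpa using congrFun this 0

theorem add (hf : IsThetaDegreeTwo τ f) (hg : IsThetaDegreeTwo τ g) :
    IsThetaDegreeTwo τ fun z ↦ f z + g z where
  differentiable := hf.differentiable.add hg.differentiable
  add_one z := by rw [hf.add_one, hg.add_one]
  add_period z := by rw [hf.add_period, hg.add_period, ← mul_add]

theorem const_mul (hf : IsThetaDegreeTwo τ f) (a : ℂ) : IsThetaDegreeTwo τ fun z ↦ a * f z where
  differentiable := hf.differentiable.const_mul a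
  add_one z := by rw [hf.add_one]
  add_period z := by rw [hf.add_period, mul_left_comm]

theorem coeff_linear_combination (hf : IsThetaDegreeTwo τ f) (hg : IsThetaDegreeTwo τ g)
    (hh : IsThetaDegreeTwo τ h) (a b c : ℂ) (n : ℤ) :
    coeff (fun z ↦ a * f z + b * g z + c * h z) n =
      a * coeff f n + b * coeff g n + c * coeff h n := by
  have hf' := hf.differentiable.continuous
  have hg' := hg.differentiable.continuous
  have hh' := hh.differentiable.continuous
  simp only [coeff, ← intervalIntegral.integral_const_mul]
  rw [← intervalIntegral.integral_add, ← intervalIntegral.integral_add]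
  · congr 1
    funext x
    ring
  all_goals exact Continuous.intervalIntegrable (by fun_prop) _ _

/-- The space of theta functions of degree two is at most two-dimensional. -/
theorem exists_linear_combination_eq_zero (hf : IsThetaDegreeTwo τ f)
    (hg : IsThetaDegreeTwo τ g) (hh : IsThetaDegreeTwo τ h) :
    ∃ a b c : ℂ, (a ≠ 0 ∨ b ≠ 0 ∨ c ≠ 0) ∧ ∀ z, a * f z + b * g z + c * h z = 0 := by
  let M : Matrix (Fin 2) (Fin 3) ℂ :=
    !![coeff f 0, coeff g 0, coeff h 0; coeff f 1, coeff g 1, coeff h 1]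
  have hker := LinearMap.ker_ne_bot_of_finrank_lt (f := M.mulVecLin) (by simp)
  obtain ⟨v, hv, hv0⟩ := (Submodule.ne_bot_iff _).1 hker
  rw [LinearMap.mem_ker, Matrix.mulVecLin_apply] at hv
  have e0 := congrFun hv 0
  have e1 := congrFun hv 1
  simp [M, Matrix.mulVec, dotProduct, Fin.sum_univ_three] at e0 e1
  refine ⟨v 0, v 1, v 2, ?_, fun z ↦ ?_⟩
  · contrapose! hv0
    funext i
    fin_cases i <;> simp [hv0]
  · refine congrFun (eq_zero_of_coeff (((hf.const_mul _).add (hg.const_mul _)).add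
      (hh.const_mul _)) ?_ ?_) z <;> rw [coeff_linear_combination hf hg hh]
    · linear_combination e0
    · linear_combination e1

end IsThetaDegreeTwo

/-- The period pair `(1, τ)`. -/
noncomputable def unitPeriodPair {τ : ℂ} (hτ : 0 < τ.im) : PeriodPair where
  ω₁ := 1
  ω₂ := τ
  indep := by
    rw [LinearIndependent.pair_iff]
    intro s t h
    have ht : t = 0 := by simpa [hτ.ne'] using congrArg Complex.im h
    refine ⟨?_, ht⟩
    simpa [ht] using h

/-- The odd theta function `θ₁(π z)`, up to a constant factor. -/
noncomputable def thetaOdd (τ z : ℂ) : ℂ :=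
  cexp (Real.pi * I * z) * jacobiTheta₂ (z + (1 / 2 + τ / 2)) τ

/-- The theta function `θ₂(π z)`, up to a constant factor. -/
noncomputable def thetaEven (τ z : ℂ) : ℂ :=
  cexp (Real.pi * I * z) * jacobiTheta₂ (z + τ / 2) τ

theorem thetaOdd_add_one (τ z : ℂ) : thetaOdd τ (z + 1) = -thetaOdd τ z := by
  rw [thetaOdd, thetaOdd, add_right_comm, jacobiTheta₂_add_left, mul_add, mul_one,
    Complex.exp_add, exp_pi_mul_I]
  ring

theorem thetaEven_add_one (τ z : ℂ) : thetaEven τ (z + 1) = -thetaEven τ z := by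
  rw [thetaEven, thetaEven, add_right_comm, jacobiTheta₂_add_left, mul_add, mul_one,
    Complex.exp_add, exp_pi_mul_I]
  ring

theorem thetaOdd_add_period (τ z : ℂ) :
    thetaOdd τ (z + τ) = -cexp (-Real.pi * I * (τ + 2 * z)) * thetaOdd τ z := by
  rw [thetaOdd, thetaOdd, add_right_comm, jacobiTheta₂_add_left', ← mul_assoc, ← mul_assoc,
    ← Complex.exp_add, neg_mul (cexp _), ← Complex.exp_add, ← neg_one_mul (cexp _),
    ← Complex.exp_pi_mul_I, ← Complex.exp_add]
  congr 1
  refine Complex.exp_eq_exp_iff_exists_int.2 ⟨-1, ?_⟩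
  push_cast
  ring

theorem thetaEven_add_period (τ z : ℂ) :
    thetaEven τ (z + τ) = cexp (-Real.pi * I * (τ + 2 * z)) * thetaEven τ z := by
  rw [thetaEven, thetaEven, add_right_comm, jacobiTheta₂_add_left', ← mul_assoc, ← mul_assoc,
    ← Complex.exp_add, ← Complex.exp_add]
  ring_nf

theorem hasDerivAt_thetaOdd {τ : ℂ} (hτ : 0 < τ.im) (z : ℂ) :
    HasDerivAt (thetaOdd τ) (cexp (Real.pi * I * z) * (Real.pi * I) *
      jacobiTheta₂ (z + (1 / 2 + τ / 2)) τ +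
      cexp (Real.pi * I * z) * jacobiTheta₂' (z + (1 / 2 + τ / 2)) τ) z := by
  refine HasDerivAt.mul ?_ ((hasDerivAt_jacobiTheta₂_fst _ hτ).comp_add_const z _)
  simpa using ((hasDerivAt_id z).const_mul (Real.pi * I)).cexp

theorem differentiable_thetaOdd {τ : ℂ} (hτ : 0 < τ.im) : Differentiable ℂ (thetaOdd τ) :=
  fun z ↦ (hasDerivAt_thetaOdd hτ z).differentiableAt

theorem differentiable_jacobiTheta₂_fst {τ : ℂ} (hτ : 0 < τ.im) :
    Differentiable ℂ fun z ↦ jacobiTheta₂ z τ :=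
  fun z ↦ differentiableAt_jacobiTheta₂_fst z hτ

theorem deriv_thetaOdd_zero {τ : ℂ} (hτ : 0 < τ.im) :
    deriv (thetaOdd τ) 0 =
      Real.pi * I * (jacobiTheta₂ (τ / 2) τ * jacobiTheta₂ 0 τ * jacobiTheta₂ (1 / 2) τ) := by
  rw [(hasDerivAt_thetaOdd hτ 0).deriv, zero_add, jacobiTheta₂_half_add_half_eq_zero,
    ← jacobiTheta₂'_half_add_half_period hτ]
  simp

theorem thetaOdd_zero (τ : ℂ) : thetaOdd τ 0 = 0 := by
  rw [thetaOdd, zero_add, jacobiTheta₂_half_add_half_eq_zero, mul_zero]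

theorem thetaEven_zero (τ : ℂ) : thetaEven τ 0 = jacobiTheta₂ (τ / 2) τ := by
  simp [thetaEven]

theorem thetaEven_half (τ : ℂ) : thetaEven τ (1 / 2) = 0 := by
  rw [thetaEven, jacobiTheta₂_half_add_half_eq_zero, mul_zero]

theorem thetaOdd_half_ne_zero {τ : ℂ} (hτ : 0 < τ.im) : thetaOdd τ (1 / 2) ≠ 0 := by
  rw [thetaOdd, show 1 / 2 + (1 / 2 + τ / 2) = τ / 2 + 1 by ring, jacobiTheta₂_add_left]
  exact mul_ne_zero (Complex.exp_ne_zero _) (jacobiTheta₂_half_period_ne_zero hτ)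

theorem thetaOdd_eq_zero_of_mem_lattice {τ : ℂ} (hτ : 0 < τ.im) {z : ℂ}
    (hz : z ∈ (unitPeriodPair hτ).lattice) : thetaOdd τ z = 0 := by
  obtain ⟨m, n, rfl⟩ := PeriodPair.mem_lattice.1 hz
  have h₁ : Function.Periodic (fun z ↦ thetaOdd τ z = 0) 1 := fun z ↦ by
    simp [thetaOdd_add_one]
  have h₂ : Function.Periodic (fun z ↦ thetaOdd τ z = 0) τ := fun z ↦ by
    simp [thetaOdd_add_period]
  have h := h₂.int_mul n (m * 1)
  have h' := h₁.int_mul m 0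
  simp only [zero_add, thetaOdd_zero, eq_iff_iff, iff_true] at h h'
  exact h.2 h'

theorem isThetaDegreeTwo_thetaOdd_sq {τ : ℂ} (hτ : 0 < τ.im) :
    IsThetaDegreeTwo τ fun z ↦ thetaOdd τ z ^ 2 where
  differentiable := (differentiable_thetaOdd hτ).pow 2
  add_one z := by rw [thetaOdd_add_one, neg_sq]
  add_period z := by
    rw [thetaOdd_add_period, mul_pow, neg_sq, ← Complex.exp_nat_mul]
    push_cast
    ring_nf

theorem isThetaDegreeTwo_thetaEven_sq {τ : ℂ} (hτ : 0 < τ.im) :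
    IsThetaDegreeTwo τ fun z ↦ thetaEven τ z ^ 2 where
  differentiable := by
    have := differentiable_jacobiTheta₂_fst hτ
    unfold thetaEven
    fun_prop
  add_one z := by rw [thetaEven_add_one, neg_sq]
  add_period z := by
    rw [thetaEven_add_period, mul_pow, ← Complex.exp_nat_mul]
    push_cast
    ring_nf

theorem isThetaDegreeTwo_jacobiTheta₂_mul {τ : ℂ} (hτ : 0 < τ.im) (c : ℂ) :
    IsThetaDegreeTwo τ fun z ↦ jacobiTheta₂ (z + c) τ * jacobiTheta₂ (z - c) τ where
  differentiable := by
    have := differentiable_jacobiTheta₂_fst hτ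
    fun_prop
  add_one z := by
    rw [add_right_comm, add_sub_right_comm, jacobiTheta₂_add_left, jacobiTheta₂_add_left]
  add_period z := by
    rw [add_right_comm, add_sub_right_comm, jacobiTheta₂_add_left', jacobiTheta₂_add_left',
      mul_mul_mul_comm, ← Complex.exp_add]
    ring_nf

open PeriodPair in
/-- The product `℘ θ₁²`, with its removable singularities filled in. -/
theorem exists_isThetaDegreeTwo_weierstrassP_mul {τ : ℂ} (hτ : 0 < τ.im) :
    ∃ F : ℂ → ℂ, IsThetaDegreeTwo τ F ∧ F 0 = deriv (thetaOdd τ) 0 ^ 2 ∧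
      ∀ z ∉ (unitPeriodPair hτ).lattice, F z = ℘[unitPeriodPair hτ] z * thetaOdd τ z ^ 2 := by
  classical
  set L := unitPeriodPair hτ with hL
  have hmem₁ : (1 : ℂ) ∈ L.lattice := L.ω₁_mem_lattice
  have hmem₂ : τ ∈ L.lattice := L.ω₂_mem_lattice
  let F (z : ℂ) : ℂ :=
    if z ∈ L.lattice then deriv (thetaOdd τ) z ^ 2 else ℘[L] z * thetaOdd τ z ^ 2
  have hF {z : ℂ} (hz : z ∈ L.lattice) : F z = deriv (thetaOdd τ) z ^ 2 := if_pos hz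
  have hF' {z : ℂ} (hz : z ∉ L.lattice) : F z = ℘[L] z * thetaOdd τ z ^ 2 := if_neg hz
  have hd := differentiable_thetaOdd hτ
  refine ⟨F, ⟨fun z₀ ↦ ?_, fun z ↦ ?_, fun z ↦ ?_⟩, hF (zero_mem _), fun z ↦ hF'⟩
  · by_cases hz₀ : z₀ ∈ L.lattice
    · have hP : DifferentiableAt ℂ ℘[L - z₀] z₀ :=
          (L.analyticAt_weierstrassPExcept z₀).differentiableAt
      have hD : DifferentiableAt ℂ (dslope (thetaOdd τ) z₀) z₀ :=
        ((Complex.differentiableOn_dslope univ_mem).2 hd.differentiableOn).differentiableAt univ_mem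
      have hsmooth : DifferentiableAt ℂ (fun z ↦ ℘[L - z₀] z * thetaOdd τ z ^ 2 +
          dslope (thetaOdd τ) z₀ z ^ 2 - thetaOdd τ z ^ 2 / z₀ ^ 2) z₀ := by
        have := hd z₀
        exact ((hP.mul (this.pow 2)).add (hD.pow 2)).sub ((this.pow 2).div_const _)
      refine hsmooth.congr_of_eventuallyEq ?_
      filter_upwards [L.compl_lattice_sdiff_singleton_mem_nhds z₀] with z hz
      have h0 := thetaOdd_eq_zero_of_mem_lattice hτ hz₀
      rcases eq_or_ne z z₀ with rfl | hne
      · rw [hF hz₀, dslope_same, h0]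
        simp
      · have hz' : z ∉ L.lattice := fun h ↦ hz ⟨h, hne⟩
        rw [hF' hz', ← L.weierstrassPExcept_add ⟨z₀, hz₀⟩, dslope_of_ne _ hne, slope_def_field, h0]
        have := sub_ne_zero.2 hne
        field_simp
        ring
    · have hP : DifferentiableAt ℂ ℘[L] z₀ :=
        L.differentiableOn_weierstrassP.differentiableAt
          (L.isClosed_lattice.isOpen_compl.mem_nhds hz₀)
      refine (hP.mul ((hd z₀).pow 2)).congr_of_eventuallyEq ?_
      filter_upwards [L.isClosed_lattice.isOpen_compl.mem_nhds hz₀] with z hz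
      exact hF' hz
  · by_cases hz : z ∈ L.lattice
    · rw [hF hz, hF (add_mem hz hmem₁), ← deriv_comp_add_const, funext (thetaOdd_add_one τ),
        deriv.fun_neg, neg_sq]
    · rw [hF' hz, hF' fun h ↦ hz (by simpa using sub_mem h hmem₁), thetaOdd_add_one, neg_sq,
        L.weierstrassP_add_coe z ⟨1, hmem₁⟩]
  · have hexp : (-cexp (-Real.pi * I * (τ + 2 * z))) ^ 2 =
        cexp (-2 * Real.pi * I * (τ + 2 * z)) := by
      rw [neg_sq, ← Complex.exp_nat_mul]
      push_cast
      ring_nf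
    by_cases hz : z ∈ L.lattice
    · rw [hF hz, hF (add_mem hz hmem₂), ← deriv_comp_add_const, funext (thetaOdd_add_period τ),
        deriv_fun_mul (by fun_prop) (hd z), thetaOdd_eq_zero_of_mem_lattice hτ hz, mul_zero,
        zero_add, mul_pow, hexp]
    · rw [hF' hz, hF' fun h ↦ hz (by simpa using sub_mem h hmem₂), thetaOdd_add_period, mul_pow,
        hexp, L.weierstrassP_add_coe z ⟨τ, hmem₂⟩]
      ring

theorem thetaOdd_ne_zero {τ : ℂ} (hτ : 0 < τ.im) {a : ℂ}
    (ha : a ∉ (unitPeriodPair hτ).lattice) : thetaOdd τ a ≠ 0 := by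
  intro h
  obtain ⟨F, hF, hF0, hF'⟩ := exists_isThetaDegreeTwo_weierstrassP_mul hτ
  have hFa : F a = 0 := by rw [hF' a ha, h]; simp
  have hD : deriv (thetaOdd τ) 0 ≠ 0 := by
    rw [deriv_thetaOdd_zero hτ]
    simp [Real.pi_ne_zero, jacobiTheta₂_half_period_ne_zero hτ, jacobiTheta₂_zero_ne_zero hτ,
      -one_div, jacobiTheta₂_half_ne_zero hτ]
  have key (c : ℂ) : jacobiTheta₂ (a + c) τ * jacobiTheta₂ (a - c) τ = 0 := by
    obtain ⟨α, β, γ, hne, hsum⟩ :=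
      (isThetaDegreeTwo_thetaOdd_sq hτ).exists_linear_combination_eq_zero
        hF (isThetaDegreeTwo_jacobiTheta₂_mul hτ c)
    have hγ : γ ≠ 0 := by
      rintro rfl
      have hβ : β = 0 := by
        have := hsum 0
        rw [thetaOdd_zero, hF0] at this
        simpa [hD] using this
      have hα : α = 0 := by
        have := hsum (1 / 2)
        rw [hβ] at this
        simpa [-one_div, thetaOdd_half_ne_zero hτ] using this
      simp [hα, hβ] at hne
    have := hsum a
    rw [h, hFa] at this
    simpa [hγ] using this
  have hdiff := differentiable_jacobiTheta₂_fst hτ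
  have h₁ : Differentiable ℂ fun c ↦ jacobiTheta₂ (a + c) τ := by fun_prop
  have h₂ : Differentiable ℂ fun c ↦ jacobiTheta₂ (a - c) τ := by fun_prop
  rcases AnalyticOnNhd.eq_zero_or_eq_zero_of_mul_eq_zero
    (h₁.differentiableOn.analyticOnNhd isOpen_univ) (h₂.differentiableOn.analyticOnNhd isOpen_univ)
    (fun c _ ↦ key c) isPreconnected_univ with h0 | h0
  · exact jacobiTheta₂_zero_ne_zero hτ (by simpa using h0 (-a) trivial)
  · exact jacobiTheta₂_zero_ne_zero hτ (by simpa using h0 a trivial)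

open PeriodPair in
theorem weierstrassP_sub_half {τ : ℂ} (hτ : 0 < τ.im) {z : ℂ}
    (hz : z ∉ (unitPeriodPair hτ).lattice) :
    ℘[unitPeriodPair hτ] z - ℘[unitPeriodPair hτ] (1 / 2) =
      -(Real.pi * jacobiTheta₂ 0 τ * jacobiTheta₂ (1 / 2) τ) ^ 2 *
        thetaEven τ z ^ 2 / thetaOdd τ z ^ 2 := by
  obtain ⟨F, hF, hF0, hF'⟩ := exists_isThetaDegreeTwo_weierstrassP_mul hτ
  have hhalf : (1 / 2 : ℂ) ∉ (unitPeriodPair hτ).lattice :=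
    (unitPeriodPair hτ).ω₁_div_two_notMem_lattice
  obtain ⟨α, β, γ, hne, hsum⟩ :=
    (isThetaDegreeTwo_thetaOdd_sq hτ).exists_linear_combination_eq_zero
      hF (isThetaDegreeTwo_thetaEven_sq hτ)
  have hc := jacobiTheta₂_half_period_ne_zero hτ
  have h0 := hsum 0
  rw [thetaOdd_zero, hF0, thetaEven_zero, deriv_thetaOdd_zero hτ] at h0
  have h1 := hsum (1 / 2)
  rw [hF' _ hhalf, thetaEven_half] at h1
  have hα : α = -β * ℘[unitPeriodPair hτ] (1 / 2) := by
    refine mul_right_cancel₀ (pow_ne_zero 2 (thetaOdd_half_ne_zero hτ)) ?_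
    linear_combination h1
  have hγ : γ = β * (Real.pi * jacobiTheta₂ 0 τ * jacobiTheta₂ (1 / 2) τ) ^ 2 := by
    refine mul_right_cancel₀ (pow_ne_zero 2 hc) ?_
    linear_combination h0 - β * (Real.pi * jacobiTheta₂ (τ / 2) τ * jacobiTheta₂ 0 τ *
      jacobiTheta₂ (1 / 2) τ) ^ 2 * I_sq
  have hβ : β ≠ 0 := by
    rintro rfl
    simp [hα, hγ] at hne
  have h2 := hsum z
  rw [hF' z hz, hα, hγ] at h2
  rw [eq_div_iff (pow_ne_zero 2 (thetaOdd_ne_zero hτ hz))]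
  refine mul_left_cancel₀ hβ ?_
  linear_combination h2

theorem theta3_zero {τ : ℂ} (hτ : 0 < τ.im) : theta3 0 τ = jacobiTheta₂ 0 τ := by
  have h := hasSum_jacobiTheta₂_term 0 hτ
  rw [jacobiTheta₂, tsum_int_eq_zero_add_two_mul_tsum_pnat (fun n ↦ by simp [jacobiTheta₂_term])
    h.summable, tsum_pnat_eq_tsum_succ (f := fun n : ℕ ↦ jacobiTheta₂_term n 0 τ), theta3,
    nsmul_eq_mul]
  congr 1
  · simp [jacobiTheta₂_term]
  · congr 2
    funext n
    simp [jacobiTheta₂_term]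
    ring_nf

theorem jacobiTheta₂_term_half (n : ℤ) (τ : ℂ) :
    jacobiTheta₂_term n (1 / 2) τ = (-1) ^ n * cexp (Real.pi * I * τ * n ^ 2) := by
  rw [jacobiTheta₂_term, ← exp_pi_mul_I, ← Complex.exp_int_mul, ← Complex.exp_add]
  ring_nf

theorem theta4_zero {τ : ℂ} (hτ : 0 < τ.im) : theta4 0 τ = jacobiTheta₂ (1 / 2) τ := by
  have h := hasSum_jacobiTheta₂_term (1 / 2) hτ
  rw [jacobiTheta₂, tsum_int_eq_zero_add_two_mul_tsum_pnat
    (fun n ↦ by simp [-one_div, jacobiTheta₂_term_half, ← inv_zpow]) h.summable,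
    tsum_pnat_eq_tsum_succ (f := fun n : ℕ ↦ jacobiTheta₂_term n (1 / 2) τ), theta4, nsmul_eq_mul]
  congr 1
  · simp [jacobiTheta₂_term]
  · congr 2
    funext n
    rw [jacobiTheta₂_term_half, zpow_natCast]
    simp

theorem theta2_pi_mul {τ : ℂ} (hτ : 0 < τ.im) (z : ℂ) :
    theta2 (Real.pi * z) τ = cexp (Real.pi * I * τ / 4) * thetaEven τ z := by
  have h := hasSum_jacobiTheta₂_term (z + τ / 2) hτ
  rw [thetaEven, jacobiTheta₂, ← tsum_nat_add_neg_add_one h.summable, ← mul_assoc,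
    ← Complex.exp_add, ← tsum_mul_left, theta2, ← tsum_mul_left]
  congr 1
  funext n
  rw [Complex.cos, jacobiTheta₂_term, jacobiTheta₂_term, mul_add, ← Complex.exp_add,
    ← Complex.exp_add, mul_div_assoc', mul_div_cancel₀ _ two_ne_zero, mul_add, ← Complex.exp_add,
    ← Complex.exp_add]
  push_cast
  ring_nf

theorem theta1_pi_mul {τ : ℂ} (hτ : 0 < τ.im) (z : ℂ) :
    theta1 (Real.pi * z) τ = -I * (cexp (Real.pi * I * τ / 4) * thetaOdd τ z) := by
  have h := hasSum_jacobiTheta₂_term (z + (1 / 2 + τ / 2)) hτ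
  have e (n : ℤ) : jacobiTheta₂_term n (z + (1 / 2 + τ / 2)) τ =
      (-1) ^ n * jacobiTheta₂_term n (z + τ / 2) τ := by
    rw [jacobiTheta₂_term, jacobiTheta₂_term, ← exp_pi_mul_I, ← Complex.exp_int_mul,
      ← Complex.exp_add]
    ring_nf
  rw [thetaOdd, jacobiTheta₂, ← tsum_nat_add_neg_add_one h.summable, ← mul_assoc (cexp _),
    ← Complex.exp_add, ← tsum_mul_left, ← tsum_mul_left, theta1, ← tsum_mul_left]
  congr 1
  funext n
  have hs : (-1 : ℂ) ^ (-((n : ℤ) + 1)) = -(-1) ^ n := by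
    rw [zpow_neg, ← inv_zpow, inv_neg_one, zpow_add_one₀ (by norm_num), zpow_natCast]
    ring
  rw [e, e, hs, zpow_natCast, Complex.sin, jacobiTheta₂_term, jacobiTheta₂_term]
  have e₁ : cexp (Real.pi * I * τ / 4 + Real.pi * I * z) *
      cexp (2 * Real.pi * I * n * (z + τ / 2) + Real.pi * I * n ^ 2 * τ) =
      cexp (Real.pi * I * τ * (n + 1 / 2) ^ 2) * cexp ((2 * n + 1) * (Real.pi * z) * I) := by
    rw [← Complex.exp_add, ← Complex.exp_add]
    ring_nf
  have e₂ : cexp (Real.pi * I * τ / 4 + Real.pi * I * z) *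
      cexp (2 * Real.pi * I * (-(n + 1)) * (z + τ / 2) + Real.pi * I * (-(n + 1)) ^ 2 * τ) =
      cexp (Real.pi * I * τ * (n + 1 / 2) ^ 2) * cexp (-((2 * n + 1) * (Real.pi * z)) * I) := by
    rw [← Complex.exp_add, ← Complex.exp_add]
    ring_nf
  push_cast
  linear_combination I * (-1) ^ n * e₁ - I * (-1) ^ n * e₂

theorem wp_eq_weierstrassP {g τ : ℂ} (hg : g ≠ 0) (hτ : 0 < τ.im) (z : ℂ) :
    wp g (g * τ) z = (1 / g) ^ 2 * (unitPeriodPair hτ).weierstrassP (z / g) := by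
  set L := unitPeriodPair hτ with hL
  let f (p : ℤ × ℤ) : ℂ := 1 / (z - (p.1 * g + p.2 * (g * τ))) ^ 2 -
    1 / (p.1 * g + p.2 * (g * τ)) ^ 2
  have hs : HasSum f ((1 / g) ^ 2 * L.weierstrassP (z / g)) := by
    have := (L.latticeEquivProd.symm.toEquiv.hasSum_iff).2 (L.hasSum_weierstrassP (z / g))
    refine (this.mul_left ((1 / g) ^ 2)).congr_fun fun p ↦ ?_
    have hp : (L.latticeEquivProd.symm p : ℂ) = p.1 + p.2 * τ := by
      rw [L.latticeEquiv_symm_apply]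
      simp [hL, unitPeriodPair]
    simp only [Function.comp, LinearEquiv.coe_toEquiv, hp, f]
    rw [mul_sub, ← one_div_pow, ← one_div_pow, ← one_div_pow, ← one_div_pow, ← mul_pow, ← mul_pow,
      one_div_mul_one_div, one_div_mul_one_div, mul_sub, mul_div_cancel₀ _ hg]
    ring_nf
  have hc : HasSum (fun p : ({0} : Set (ℤ × ℤ)) ↦ f p) (1 / z ^ 2) := by
    convert hasSum_unique (fun p : ({0} : Set (ℤ × ℤ)) ↦ f p)
    simp [f, Set.default_coe_singleton]
  rw [← hs.tsum_eq, ← hs.summable.tsum_subtype_add_tsum_subtype_compl {0}, hc.tsum_eq, wp]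
  rfl

end

/-- ℘(z|Λ) − e₁ expressed via theta functions, Λ = {2mω₁ + 2nω₂}, e₁ = ℘(ω₁|Λ). -/
theorem wp_sub_e1_eq_theta (ω1 ω2 : ℂ) (h : 0 < (ω2 / ω1).im) (z : ℂ)
    (hz : ∀ m n : ℤ, z ≠ 2 * (m : ℂ) * ω1 + 2 * (n : ℂ) * ω2) :
    wp (2 * ω1) (2 * ω2) z - wp (2 * ω1) (2 * ω2) ω1 =
      ((Real.pi : ℂ) * theta3 0 (ω2 / ω1) * theta4 0 (ω2 / ω1) / (2 * ω1)) ^ 2 *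
        (theta2 ((Real.pi : ℂ) * z / (2 * ω1)) (ω2 / ω1)) ^ 2 /
        (theta1 ((Real.pi : ℂ) * z / (2 * ω1)) (ω2 / ω1)) ^ 2 := by
  have hω : ω1 ≠ 0 := by
    rintro rfl
    simp at h
  set τ := ω2 / ω1 with hτ
  have hω2 : 2 * ω2 = 2 * ω1 * τ := by
    rw [hτ]
    field_simp
  have hg : 2 * ω1 ≠ 0 := mul_ne_zero two_ne_zero hω
  have hz' : z / (2 * ω1) ∉ (unitPeriodPair h).lattice := by
    intro hmem
    obtain ⟨m, n, hmn⟩ := PeriodPair.mem_lattice.1 hmem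
    apply hz m n
    have hmn' : (m : ℂ) * 1 + n * τ = z / (2 * ω1) := hmn
    rw [eq_div_iff hg] at hmn'
    linear_combination -hmn' - n * hω2
  have hhalf : ω1 / (2 * ω1) = 1 / 2 := by field_simp
  have hE := Complex.exp_ne_zero (Real.pi * Complex.I * τ / 4)
  have hO := thetaOdd_ne_zero h hz'
  rw [hω2, wp_eq_weierstrassP hg h, wp_eq_weierstrassP hg h, hhalf, ← mul_sub,
    weierstrassP_sub_half h hz', theta3_zero h, theta4_zero h, mul_div_assoc _ z, theta2_pi_mul h,
    theta1_pi_mul h, mul_pow (-Complex.I), neg_sq, Complex.I_sq]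
  field_simp
end
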